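/- arXiv:2103.12866 — 8 statements merged into one kernel-verified Lean document; each statement's English description precedes it below -/
import Mathlib

section
/- PAC-Bayesian bound (Theorem 1, Alquier et al.): Let (Ω,F,P) be a probability space, (Θ,B) a measurable space carrying two probability measures π (the prior) and ρ̂ (the posterior) with ρ̂ absolutely continuous with respect to π. Let r : Θ → ℝ be measurable (the generalization error) and R : Θ × Ω → ℝ be jointly measurable (the empirical error), with r and ω ↦ R(θ,ω) suitably integrable. Fix λ > 0 and δ ∈ (0,1], and suppose Ψ := log ∫_Θ ∫_Ω exp(λ(r(θ) − R(θ,ω))) dP(ω) dπ(θ) is finite, KL(ρ̂‖π) is finite, and r and R(·,ω) are ρ̂-integrable. Then P({ω ∈ Ω : ∫_Θ r dρ̂ ≤ ∫_Θ R(θ,ω) dρ̂(θ) + (1/λ)·( KL(ρ̂‖π) + log(1/δ) + Ψ ) }) ≥ 1 − δ. -/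
open MeasureTheory

/-- The Donsker–Varadhan change of measure inequality. -/
lemma integral_le_integral_llr_add_log_integral_exp {α : Type*} [MeasurableSpace α]
    {μ ν : Measure α} [IsProbabilityMeasure μ] [IsProbabilityMeasure ν] (hμν : μ ≪ ν)
    {f : α → ℝ} (hfμ : Integrable f μ) (hfν : Integrable (fun x ↦ Real.exp (f x)) ν)
    (h_int : Integrable (llr μ ν) μ) :
    ∫ x, f x ∂μ ≤ ∫ x, llr μ ν x ∂μ + Real.log (∫ x, Real.exp (f x) ∂ν) := by
  have : IsProbabilityMeasure (ν.tilted f) := isProbabilityMeasure_tilted hfν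
  have hac : μ ≪ ν.tilted f := hμν.trans (absolutelyContinuous_tilted hfν)
  have h_nonneg := InformationTheory.integral_llr_add_sub_measure_univ_nonneg hac
    (integrable_llr_tilted_right hμν hfμ h_int hfν)
  rw [integral_llr_tilted_right hμν hfμ hfν h_int] at h_nonneg
  simp only [probReal_univ] at h_nonneg
  linarith

/-- PAC-Bayesian bound (Theorem 1, Alquier et al.). `P` is a probability
measure on `Ω`, `pri` (the prior) and `post` (the posterior) are probability
measures on `Θ` with `post ≪ pri`; `r` is the generalization error and `R` the
empirical error. The Kullback–Leibler divergence `KL(post‖pri)` is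
`∫ log (d post/d pri) d post`, expressed via the Radon–Nikodym derivative. -/
theorem pac_bayes_bound
    {Ω : Type*} [MeasurableSpace Ω] (P : Measure Ω) [IsProbabilityMeasure P]
    {Θ : Type*} [MeasurableSpace Θ] (pri post : Measure Θ)
    [IsProbabilityMeasure pri] [IsProbabilityMeasure post]
    (habs : post ≪ pri)
    (r : Θ → ℝ) (R : Θ → Ω → ℝ)
    (hr : Measurable r)
    (hR : Measurable (Function.uncurry R))
    (lam : ℝ) (hlam : 0 < lam)
    (δ : ℝ) (hδ0 : 0 < δ) (hδ1 : δ ≤ 1)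
    (hΨ : Integrable
      (fun q : Θ × Ω => Real.exp (lam * (r q.1 - R q.1 q.2))) (pri.prod P))
    (hKL : Integrable (fun θ => Real.log ((post.rnDeriv pri θ).toReal)) post)
    (hrInt : Integrable r post)
    (hRInt : ∀ ω : Ω, Integrable (fun θ => R θ ω) post) :
    P {ω : Ω |
        ∫ θ, r θ ∂post ≤ (∫ θ, R θ ω ∂post)
          + (1 / lam) *
            ((∫ θ, Real.log ((post.rnDeriv pri θ).toReal) ∂post)
              + Real.log (1 / δ)
              + Real.log
                  (∫ θ, ∫ ω', Real.exp (lam * (r θ - R θ ω')) ∂P ∂pri))}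
      ≥ ENNReal.ofReal (1 - δ) := by
  set g : Θ × Ω → ℝ := fun q ↦ Real.exp (lam * (r q.1 - R q.1 q.2))
  set Z : Ω → ℝ := fun ω ↦ ∫ θ, g (θ, ω) ∂pri
  set I : ℝ := ∫ θ, ∫ ω', Real.exp (lam * (r θ - R θ ω')) ∂P ∂pri
  have hg_meas : Measurable g := by
    have : Measurable fun q : Θ × Ω ↦ R q.1 q.2 := hR
    fun_prop
  have hZ_meas : Measurable Z :=
    (hg_meas.stronglyMeasurable.integral_prod_left' (μ := pri)).measurable
  have hZ_int : Integrable Z P := hΨ.integral_prod_right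
  have hZ_nonneg : 0 ≤ᵐ[P] Z :=
    ae_of_all _ fun ω ↦ integral_nonneg fun θ ↦ (Real.exp_pos _).le
  have hI_prod : I = ∫ q, g q ∂(pri.prod P) := (integral_prod g hΨ).symm
  have hI_eq : ∫ ω, Z ω ∂P = I := by rw [hI_prod, integral_prod_symm g hΨ]
  have hI_pos : 0 < I := by rw [hI_prod]; exact integral_exp_pos hΨ
  have h_markov : P {ω | I / δ ≤ Z ω} ≤ ENNReal.ofReal δ := by
    have h := mul_meas_ge_le_integral_of_nonneg hZ_nonneg hZ_int (I / δ)
    rw [hI_eq, div_mul_eq_mul_div, div_le_iff₀ hδ0] at h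
    rw [← ofReal_measureReal]
    exact ENNReal.ofReal_le_ofReal (le_of_mul_le_mul_left h hI_pos)
  have h_compl : ENNReal.ofReal (1 - δ) ≤ P {ω | I / δ ≤ Z ω}ᶜ := by
    rw [prob_compl_eq_one_sub (measurableSet_le measurable_const hZ_meas),
      ENNReal.ofReal_sub _ hδ0.le, ENNReal.ofReal_one]
    exact tsub_le_tsub_left h_markov 1
  refine h_compl.trans (measure_mono_ae ?_)
  filter_upwards [hΨ.prod_left_ae] with ω hω hlt
  have hlt : Z ω < I / δ := not_le.mp hlt
  have hZ_pos : 0 < Z ω := integral_exp_pos hω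
  have h_dv := integral_le_integral_llr_add_log_integral_exp habs
    ((hrInt.sub (hRInt ω)).const_mul lam) hω hKL
  have h_log : Real.log (Z ω) ≤ Real.log (1 / δ) + Real.log I := by
    rw [← Real.log_mul (by positivity) hI_pos.ne', one_div_mul_eq_div]
    exact Real.log_le_log hZ_pos hlt.le
  have h_lin : ∫ θ, lam * (r θ - R θ ω) ∂post = lam * (∫ θ, r θ ∂post - ∫ θ, R θ ω ∂post) := by
    rw [integral_const_mul, integral_sub hrInt (hRInt ω)]
  have h_main : lam * (∫ θ, r θ ∂post - ∫ θ, R θ ω ∂post) ≤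
      (∫ θ, Real.log ((post.rnDeriv pri θ).toReal) ∂post) + Real.log (1 / δ) + Real.log I := by
    rw [← h_lin, add_assoc]
    exact h_dv.trans (add_le_add le_rfl h_log)
  rw [← le_div_iff₀' hlam, ← one_div_mul_eq_div] at h_main
  exact sub_le_iff_le_add'.mp h_main
end

section
/- Key bound in the PAC-Bayesian theorem for stochastic LTI systems: let (Ω,F,P) be a probability space and y(0),…,y(N) random vectors in ℝ^p such that the stacked vector (y(0),…,y(N)) ∈ ℝ^{p(N+1)} has a centered Gaussian law. Let Â ∈ ℝ^{n×n}, K̂ ∈ ℝ^{n×p}, Ĉ ∈ ℝ^{p×n}, and for t = 1,…,N define the prediction error z(t) = y(t) − Σ_{k=1}^{t} Ĉ(Â−K̂Ĉ)^{k−1}K̂ · y(t−k). Let Z = (z(1),…,z(N)) ∈ ℝ^{pN}, let Q = E[Z Zᵀ], and suppose the smallest eigenvalue ρ_N of Q is strictly positive. Then for every λ > 0, E[ exp( −(λ/N) · Σ_{t=1}^N ‖z(t)‖² ) ] ≤ ( 1 + 2λρ_N/N )^{−pN/2}. -/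
open MeasureTheory ProbabilityTheory Matrix

/-- The Laplace transform at `r / 2` of the square of a centered real Gaussian variable. -/
lemma integral_exp_neg_mul_sq_gaussianReal {v : NNReal} (hv : v ≠ 0) {r : ℝ} (hr : 0 < r) :
    ∫ x, Real.exp (-(r / 2) * x ^ 2) ∂(gaussianReal 0 v) = (1 + v * r) ^ (-(1 : ℝ) / 2) := by
  have hv' : (0 : ℝ) < v := by positivity
  rw [integral_gaussianReal_eq_integral_smul hv]
  have h : ∀ x : ℝ, gaussianPDFReal 0 v x • Real.exp (-(r / 2) * x ^ 2)
      = (√(2 * Real.pi * v))⁻¹ * Real.exp (-((1 + v * r) / (2 * v)) * x ^ 2) := by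
    intro x
    rw [gaussianPDFReal, smul_eq_mul, mul_assoc, ← Real.exp_add]
    congr 2
    field_simp
    ring
  simp_rw [h]
  rw [integral_const_mul, integral_gaussian, ← Real.sqrt_inv, ← Real.sqrt_mul (by positivity),
    neg_div, Real.rpow_neg (by positivity), ← Real.sqrt_eq_rpow, ← Real.sqrt_inv]
  congr 1
  have := Real.pi_pos
  field_simp

/-- The characteristic function of a product of identical centered real Gaussian laws. -/
lemma integral_cexp_sum_pi_gaussianReal {ι : Type*} [Fintype ι] (v : NNReal) (z : ι → ℝ) :
    ∫ g : ι → ℝ, Complex.exp ((∑ i, g i * z i : ℝ) * Complex.I)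
        ∂(Measure.pi fun _ : ι => gaussianReal 0 v)
      = Real.exp (-(v / 2) * ∑ i, z i ^ 2) := by
  have h : ∀ g : ι → ℝ, Complex.exp ((∑ i, g i * z i : ℝ) * Complex.I)
      = ∏ i, Complex.exp (z i * g i * Complex.I) := by
    intro g
    rw [← Complex.exp_sum]
    push_cast
    rw [Finset.sum_mul]
    congr 1
    exact Finset.sum_congr rfl fun i _ => by ring
  simp_rw [h]
  rw [integral_fintype_prod_eq_prod (μ := fun _ : ι => gaussianReal 0 v)
    (fun i (x : ℝ) => Complex.exp (z i * x * Complex.I))]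
  simp_rw [← charFun_apply_real, charFun_gaussianReal]
  rw [← Complex.exp_sum, Complex.ofReal_exp]
  congr 1
  push_cast
  rw [Finset.mul_sum]
  exact Finset.sum_congr rfl fun i _ => by ring

/-- A quadratic form dominates its minimum on the unit sphere times the squared norm. -/
lemma mul_sum_sq_le_dotProduct_mulVec {ι : Type*} [Fintype ι] {Q : Matrix ι ι ℝ} {ρ : ℝ}
    (hρ : ∀ x : ι → ℝ, ∑ i, x i ^ 2 = 1 → ρ ≤ x ⬝ᵥ Q.mulVec x) (x : ι → ℝ) :
    ρ * ∑ i, x i ^ 2 ≤ x ⬝ᵥ Q.mulVec x := by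
  rcases (Finset.sum_nonneg fun i _ => sq_nonneg (x i) : 0 ≤ ∑ i, x i ^ 2).eq_or_lt with h | h
  · have hx : x = 0 := funext fun i => by
      simpa using (Finset.sum_eq_zero_iff_of_nonneg fun i _ => sq_nonneg (x i)).1 h.symm i
        (Finset.mem_univ i)
    simp [hx]
  · have hs := Real.sq_sqrt h.le
    have h1 := hρ ((√(∑ i, x i ^ 2))⁻¹ • x) (by
      simp only [Pi.smul_apply, smul_eq_mul, mul_pow, ← Finset.mul_sum, inv_pow, hs]
      exact inv_mul_cancel₀ h.ne')
    rw [mulVec_smul, smul_dotProduct, dotProduct_smul, smul_eq_mul, smul_eq_mul, ← mul_assoc,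
      ← mul_inv, ← sq, hs, inv_mul_eq_div, le_div_iff₀ h] at h1
    exact h1

section GaussianFamily

variable {Ω ι : Type*} [MeasurableSpace Ω] {P : Measure Ω} [Fintype ι] {Z : ι → Ω → ℝ}
  {Q : Matrix ι ι ℝ}

/-- The characteristic function of a centered Gaussian family with second moment matrix `Q`. -/
lemma integral_cexp_sum_eq_exp_dotProduct_mulVec (hZ : ∀ i, Measurable (Z i))
    (hG : ∀ x : ι → ℝ, ∃ v : NNReal, P.map (fun ω => ∑ i, x i * Z i ω) = gaussianReal 0 v)
    (hQ : ∀ i j, Q i j = ∫ ω, Z i ω * Z j ω ∂P) (x : ι → ℝ) :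
    ∫ ω, Complex.exp ((∑ i, x i * Z i ω : ℝ) * Complex.I) ∂P
      = Real.exp (-(x ⬝ᵥ Q.mulVec x) / 2) := by
  classical
  have hL : ∀ i, MemLp (Z i) 2 P := by
    intro i
    obtain ⟨v, hv⟩ := hG (Pi.single i 1)
    simp only [Pi.single_apply, ite_mul, one_mul, zero_mul, Finset.sum_ite_eq', Finset.mem_univ,
      if_true] at hv
    have h : MemLp id 2 (P.map (Z i)) := hv ▸ memLp_id_gaussianReal 2
    exact (memLp_map_measure_iff (by fun_prop) (hZ i).aemeasurable).1 h
  obtain ⟨v, hv⟩ := hG x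
  have hm : Measurable fun ω => ∑ i, x i * Z i ω := by fun_prop
  have hvar : (v : ℝ) = x ⬝ᵥ Q.mulVec x := by
    have h1 : ∫ u, u ^ 2 ∂(gaussianReal 0 v) = v := by
      rw [← variance_fun_id_gaussianReal (μ := 0) (v := v),
        variance_of_integral_eq_zero (by fun_prop) (by simp)]
    rw [← h1, ← hv, integral_map hm.aemeasurable (by fun_prop)]
    simp_rw [sq, Finset.sum_mul_sum]
    have hint : ∀ i j, Integrable (fun ω => x i * Z i ω * (x j * Z j ω)) P := fun i j =>
      ((hL i).const_mul (x i)).integrable_mul ((hL j).const_mul (x j))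
    rw [integral_finsetSum _ fun i _ => integrable_finsetSum _ fun j _ => hint i j]
    simp only [dotProduct, mulVec, Finset.mul_sum]
    refine Finset.sum_congr rfl fun i _ => ?_
    rw [integral_finsetSum _ fun j _ => hint i j]
    refine Finset.sum_congr rfl fun j _ => ?_
    rw [hQ, ← integral_mul_const, ← integral_const_mul]
    exact integral_congr_ae (.of_forall fun ω => by ring)
  have h := charFun_gaussianReal (μ := 0) (v := v) 1
  rw [charFun_apply_real, ← hv, integral_map hm.aemeasurable (by fun_prop), hvar] at h
  rw [Complex.ofReal_exp]
  convert h using 2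
  · simp
  · push_cast; ring

/-- The Laplace transform of the squared norm of a centered Gaussian family whose second moment
matrix is bounded below by `ρ`. -/
lemma integral_exp_neg_mul_sum_sq_le [IsProbabilityMeasure P] (hZ : ∀ i, Measurable (Z i))
    (hG : ∀ x : ι → ℝ, ∃ v : NNReal, P.map (fun ω => ∑ i, x i * Z i ω) = gaussianReal 0 v)
    (hQ : ∀ i j, Q i j = ∫ ω, Z i ω * Z j ω ∂P) {ρ : ℝ} (hρ : 0 < ρ)
    (hle : ∀ x : ι → ℝ, ρ * ∑ i, x i ^ 2 ≤ x ⬝ᵥ Q.mulVec x) {v : NNReal} (hv : v ≠ 0) :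
    ∫ ω, Real.exp (-(v / 2) * ∑ i, Z i ω ^ 2) ∂P
      ≤ (1 + v * ρ) ^ (-(Fintype.card ι : ℝ) / 2) := by
  set ν : Measure (ι → ℝ) := Measure.pi fun _ => gaussianReal 0 v
  have hint : Integrable (fun q : Ω × (ι → ℝ) =>
      Complex.exp ((∑ i, q.2 i * Z i q.1 : ℝ) * Complex.I)) (P.prod ν) := by
    refine Integrable.of_bound (C := 1) ?_ (.of_forall fun q => ?_)
    · exact Measurable.aestronglyMeasurable (by fun_prop)
    · rw [Complex.norm_exp_ofReal_mul_I]
  have hswap : ∫ ω, Real.exp (-(v / 2) * ∑ i, Z i ω ^ 2) ∂P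
      = ∫ g, Real.exp (-(g ⬝ᵥ Q.mulVec g) / 2) ∂ν := by
    apply Complex.ofReal_injective
    rw [← integral_complex_ofReal, ← integral_complex_ofReal]
    simp_rw [← integral_cexp_sum_pi_gaussianReal,
      ← integral_cexp_sum_eq_exp_dotProduct_mulVec hZ hG hQ]
    exact integral_integral_swap hint
  have hexp : ∀ g : ι → ℝ, Real.exp (-(ρ * ∑ i, g i ^ 2) / 2)
      = ∏ i, Real.exp (-(ρ / 2) * g i ^ 2) := by
    intro g
    rw [← Real.exp_sum, ← Finset.mul_sum]
    congr 1
    ring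
  have hbound : ∀ q : ι → ℝ, 0 ≤ ρ * ∑ i, q i ^ 2 := fun q =>
    mul_nonneg hρ.le (Finset.sum_nonneg fun i _ => sq_nonneg (q i))
  rw [hswap]
  calc ∫ g, Real.exp (-(g ⬝ᵥ Q.mulVec g) / 2) ∂ν
      ≤ ∫ g, Real.exp (-(ρ * ∑ i, g i ^ 2) / 2) ∂ν := by
        refine integral_mono_of_nonneg (.of_forall fun g => (Real.exp_pos _).le) ?_
          (.of_forall fun g => ?_)
        · refine Integrable.of_bound (C := 1) (Measurable.aestronglyMeasurable (by fun_prop))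
            (.of_forall fun g => ?_)
          rw [Real.norm_eq_abs, Real.abs_exp, Real.exp_le_one_iff]
          linarith [hbound g]
        · exact Real.exp_le_exp.2 (by linarith [hle g])
    _ = (1 + v * ρ) ^ (-(Fintype.card ι : ℝ) / 2) := by
        simp_rw [hexp]
        rw [integral_fintype_prod_eq_pow (μ := gaussianReal 0 v)
          (fun x : ℝ => Real.exp (-(ρ / 2) * x ^ 2)), integral_exp_neg_mul_sq_gaussianReal hv hρ,
          ← Real.rpow_natCast, ← Real.rpow_mul (by positivity)]
        congr 1
        ring

end GaussianFamily

/-- Key bound in the PAC-Bayesian theorem for stochastic LTI systems.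
`y 0, …, y N` are random vectors in `ℝ^p` whose stacked vector has a centered
Gaussian law (every linear functional of it is a centered real Gaussian);
`z t = y t − Σ_{k=1}^{t} Ĉ(Â−K̂Ĉ)^{k−1}K̂ · y (t−k)` for `t = 1,…,N` is the
prediction error of the linear predictor given by `(Â, K̂, Ĉ)`; `Q` is the
covariance matrix of the stacked error `(z 1, …, z N)` and `ρN > 0` is its
smallest eigenvalue. Then
`E[exp (−(λ/N) Σ_{t=1}^N ‖z t‖²)] ≤ (1 + 2λρN/N)^(−pN/2)`. -/
theorem lti_pac_key_bound
    {Ω : Type*} [MeasurableSpace Ω] (P : Measure Ω) [IsProbabilityMeasure P]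
    (p n N : ℕ) (hN : 1 ≤ N)
    (y : ℕ → Ω → (Fin p → ℝ)) (hy : ∀ t, Measurable (y t))
    (hGauss : ∀ a : Fin (N + 1) → Fin p → ℝ, ∃ v : NNReal,
      Measure.map (fun ω => ∑ t : Fin (N + 1), a t ⬝ᵥ y (t : ℕ) ω) P
        = gaussianReal 0 v)
    (Ahat : Matrix (Fin n) (Fin n) ℝ) (Khat : Matrix (Fin n) (Fin p) ℝ)
    (Chat : Matrix (Fin p) (Fin n) ℝ)
    (z : ℕ → Ω → (Fin p → ℝ))
    (hz : ∀ t, 1 ≤ t → t ≤ N → ∀ ω,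
      z t ω = y t ω - ∑ k ∈ Finset.Icc 1 t,
        (Chat * (Ahat - Khat * Chat) ^ (k - 1) * Khat).mulVec (y (t - k) ω))
    (Q : Matrix (Fin N × Fin p) (Fin N × Fin p) ℝ)
    (hQ : ∀ (t s : Fin N) (i j : Fin p),
      Q (t, i) (s, j) = ∫ ω, z ((t : ℕ) + 1) ω i * z ((s : ℕ) + 1) ω j ∂P)
    (ρN : ℝ) (hρpos : 0 < ρN)
    (hρ : IsLeast {v : ℝ | ∃ x : Fin N × Fin p → ℝ,
      (∑ i, x i ^ 2) = 1 ∧ v = x ⬝ᵥ Q.mulVec x} ρN)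
    (lam : ℝ) (hlam : 0 < lam) :
    ∫ ω, Real.exp (-(lam / N) * ∑ t ∈ Finset.Icc 1 N, ∑ i, z t ω i ^ 2) ∂P
      ≤ (1 + 2 * lam * ρN / N) ^ (-((p : ℝ) * N) / 2) := by
  have hvar : (0 : ℝ) < 2 * lam / N := by positivity
  let S : Submodule ℝ (Ω → ℝ) :=
    { carrier := {f | ∃ a : Fin (N + 1) → Fin p → ℝ,
        f = fun ω => ∑ t : Fin (N + 1), a t ⬝ᵥ y (t : ℕ) ω}
      add_mem' := by
        rintro _ _ ⟨a, rfl⟩ ⟨b, rfl⟩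
        exact ⟨a + b, funext fun ω => by simp [add_dotProduct, Finset.sum_add_distrib]⟩
      zero_mem' := ⟨0, funext fun ω => by simp⟩
      smul_mem' := by
        rintro c _ ⟨a, rfl⟩
        exact ⟨c • a, funext fun ω => by simp [smul_dotProduct, Finset.mul_sum]⟩ }
  have hyS : ∀ t ≤ N, ∀ i, (fun ω => y t ω i) ∈ S := by
    intro t ht i
    refine ⟨Pi.single ⟨t, Nat.lt_succ_of_le ht⟩ (Pi.single i 1), funext fun ω => ?_⟩
    rw [Finset.sum_eq_single ⟨t, Nat.lt_succ_of_le ht⟩]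
    · simp
    · intro s _ hs
      simp [Pi.single_eq_of_ne hs]
    · simp
  have hzS : ∀ (t : Fin N) i, (fun ω => z (t + 1) ω i) ∈ S := by
    intro t i
    have h : (fun ω => z (t + 1) ω i) = (fun ω => y (t + 1) ω i)
        - ∑ k ∈ Finset.Icc 1 ((t : ℕ) + 1), ∑ j,
          (Chat * (Ahat - Khat * Chat) ^ (k - 1) * Khat) i j • fun ω => y (t + 1 - k) ω j := by
      funext ω
      rw [hz _ (by omega) (by omega)]
      simp [mulVec, dotProduct, Finset.sum_apply]
    rw [h]
    exact S.sub_mem (hyS _ (by omega) i) (S.sum_mem fun k _ => S.sum_mem fun j _ =>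
      S.smul_mem _ (hyS _ (by omega) j))
  have hmeas : ∀ f ∈ S, Measurable f := by
    rintro _ ⟨a, rfl⟩
    simp only [dotProduct]
    fun_prop
  have key := integral_exp_neg_mul_sum_sq_le (P := P) (Q := Q) (ρ := ρN)
    (Z := fun (q : Fin N × Fin p) ω => z (q.1 + 1) ω q.2) (fun q => hmeas _ (hzS q.1 q.2))
    (fun x => by
      obtain ⟨a, ha⟩ : (∑ q : Fin N × Fin p, x q • fun ω => z (q.1 + 1) ω q.2) ∈ S :=
        S.sum_mem fun q _ => S.smul_mem _ (hzS q.1 q.2)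
      obtain ⟨v, hv⟩ := hGauss a
      refine ⟨v, ?_⟩
      rw [← hv, ← ha]
      congr 1
      funext ω
      simp [Finset.sum_apply])
    (fun q r => hQ q.1 r.1 q.2 r.2) hρpos
    (mul_sum_sq_le_dotProduct_mulVec fun x hx => hρ.2 ⟨x, hx, rfl⟩)
    (v := (2 * lam / N).toNNReal) (Real.toNNReal_pos.2 hvar).ne'
  have hsum : ∀ ω, ∑ t ∈ Finset.Icc 1 N, ∑ i, z t ω i ^ 2
      = ∑ q : Fin N × Fin p, z (q.1 + 1) ω q.2 ^ 2 := by
    intro ω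
    rw [Fintype.sum_prod_type, Fin.sum_univ_eq_sum_range (fun t => ∑ i, z (t + 1) ω i ^ 2) N,
      Finset.range_eq_Ico, Finset.sum_Ico_add' (fun t => ∑ i, z t ω i ^ 2) 0 N 1]
    rfl
  simp_rw [hsum]
  convert key using 3
  · congr 2
    rw [Real.coe_toNNReal _ hvar.le]
    ring
  · rw [Real.coe_toNNReal _ hvar.le]
    ring
  · simp only [Fintype.card_prod, Fintype.card_fin, Nat.cast_mul]
    ring
end

section
/- Existence of a minimal tuple (Lemma, part 1): let Â ∈ ℝ^{n×n}, K̂ ∈ ℝ^{n×p}, Ĉ ∈ ℝ^{p×n} be such that Â and Â−K̂Ĉ both have spectral radius strictly less than 1. Then there exist m ≤ n and matrices A_m ∈ ℝ^{m×m}, K_m ∈ ℝ^{m×p}, C_m ∈ ℝ^{p×m} such that (A_m,K_m,C_m) is a minimal tuple and its Markov parameters coincide with those of (Â,K̂,Ĉ): for all k ≥ 1, C_m(A_m−K_mC_m)^{k−1}K_m = Ĉ(Â−K̂Ĉ)^{k−1}K̂. -/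
open Matrix

/-- `(A, K)` is controllable: the columns of `K, AK, …, A^{n−1}K` span `ℝ^n`. -/
def Controllable {n p : ℕ} (A : Matrix (Fin n) (Fin n) ℝ)
    (K : Matrix (Fin n) (Fin p) ℝ) : Prop :=
  Submodule.span ℝ {v : Fin n → ℝ | ∃ k < n, ∃ j : Fin p, v = (A ^ k * K)ᵀ j} = ⊤

/-- `(C, A)` is observable: the intersection of the kernels of
`C, CA, …, CA^{n−1}` is `{0}`. -/
def Observable {n p : ℕ} (C : Matrix (Fin p) (Fin n) ℝ)
    (A : Matrix (Fin n) (Fin n) ℝ) : Prop :=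
  ∀ x : Fin n → ℝ, (∀ k < n, (C * A ^ k).mulVec x = 0) → x = 0

/-- `A` has spectral radius strictly less than `1`: every complex eigenvalue of
`A` has absolute value `< 1`. -/
def SchurStable {n : ℕ} (A : Matrix (Fin n) (Fin n) ℝ) : Prop :=
  ∀ μ ∈ spectrum ℂ (A.map (fun x : ℝ => (x : ℂ))), ‖μ‖ < 1

/-- A tuple `(A, K, C)` is minimal if `(A, K)` is controllable, `(C, A)` is
observable, and both `A` and `A − KC` have spectral radius `< 1`. -/
def MinimalTuple {n p : ℕ} (A : Matrix (Fin n) (Fin n) ℝ)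
    (K : Matrix (Fin n) (Fin p) ℝ) (C : Matrix (Fin p) (Fin n) ℝ) : Prop :=
  Controllable A K ∧ Observable C A ∧ SchurStable A ∧ SchurStable (A - K * C)

theorem SchurStable.transpose {n : ℕ} {A : Matrix (Fin n) (Fin n) ℝ} (hA : SchurStable A) :
    SchurStable Aᵀ := by
  intro μ hμ
  refine hA μ ?_
  rw [Matrix.mem_spectrum_iff_isRoot_charpoly] at hμ ⊢
  rwa [Matrix.transpose_map, Matrix.charpoly_transpose] at hμ

/-- Schur stability passes to the restriction of a matrix to an invariant subspace. -/
theorem SchurStable.of_intertwining {n r : ℕ} {A : Matrix (Fin n) (Fin n) ℝ}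
    {B : Matrix (Fin r) (Fin r) ℝ} {P : Matrix (Fin n) (Fin r) ℝ} {Q : Matrix (Fin r) (Fin n) ℝ}
    (hA : SchurStable A) (hQP : Q * P = 1) (hAP : A * P = P * B) : SchurStable B := by
  intro μ hμ
  refine hA μ ?_
  rw [← Matrix.spectrum_toLin', ← Module.End.hasEigenvalue_iff_mem_spectrum] at hμ ⊢
  obtain ⟨v, hv⟩ := hμ.exists_hasEigenvector
  have hv1 := hv.apply_eq_smul
  rw [Matrix.toLin'_apply] at hv1
  have hQP' : Q.map Complex.ofRealHom * P.map Complex.ofRealHom = 1 := by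
    rw [← Matrix.map_mul, hQP, Matrix.map_one _ (map_zero _) (map_one _)]
  have hAP' : A.map Complex.ofRealHom * P.map Complex.ofRealHom
      = P.map Complex.ofRealHom * B.map Complex.ofRealHom := by
    rw [← Matrix.map_mul, hAP, Matrix.map_mul]
  refine Module.End.hasEigenvalue_of_hasEigenvector (x := P.map Complex.ofRealHom *ᵥ v)
    (Module.End.hasEigenvector_iff.2 ⟨Module.End.mem_eigenspace_iff.2 ?_, fun h => hv.2 ?_⟩)
  · rw [Matrix.toLin'_apply]
    change A.map Complex.ofRealHom *ᵥ _ = _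
    change B.map Complex.ofRealHom *ᵥ _ = _ at hv1
    rw [Matrix.mulVec_mulVec, hAP', ← Matrix.mulVec_mulVec, hv1, Matrix.mulVec_smul]
  · rw [← Matrix.one_mulVec v, ← hQP', ← Matrix.mulVec_mulVec, h, Matrix.mulVec_zero]

theorem pow_mul_col_mem_span {n p : ℕ} (A : Matrix (Fin n) (Fin n) ℝ)
    (K : Matrix (Fin n) (Fin p) ℝ) (k : ℕ) (j : Fin p) :
    (A ^ k * K)ᵀ j ∈
      Submodule.span ℝ {v : Fin n → ℝ | ∃ k < n, ∃ j : Fin p, v = (A ^ k * K)ᵀ j} := by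
  rcases Nat.eq_zero_or_pos n with rfl | hn
  · rw [Subsingleton.elim ((A ^ k * K)ᵀ j) 0]
    exact Submodule.zero_mem _
  have hdeg : (Polynomial.X ^ k %ₘ A.charpoly).natDegree < n := by
    have h1 : A.charpoly ≠ 1 := fun h => by
      have := A.charpoly_natDegree_eq_dim
      simp [h] at this
      omega
    simpa using Polynomial.natDegree_modByMonic_lt (Polynomial.X ^ k) A.charpoly_monic h1
  have hcol : ∀ M : Matrix (Fin n) (Fin n) ℝ, (M * K)ᵀ j = M *ᵥ Kᵀ j := fun M => rfl
  rw [hcol, Matrix.pow_eq_aeval_mod_charpoly, Polynomial.aeval_eq_sum_range' hdeg,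
    Matrix.sum_mulVec]
  refine Submodule.sum_mem _ fun i hi => ?_
  rw [Matrix.smul_mulVec]
  exact Submodule.smul_mem _ _ (Submodule.subset_span ⟨i, Finset.mem_range.1 hi, j, rfl⟩)

/-- Restricting an uncontrollable pair to its controllable subspace. -/
theorem exists_restriction_of_not_controllable {n p : ℕ} {A : Matrix (Fin n) (Fin n) ℝ}
    {K : Matrix (Fin n) (Fin p) ℝ} (h : ¬ Controllable A K) :
    ∃ r < n, ∃ (P : Matrix (Fin n) (Fin r) ℝ) (Q : Matrix (Fin r) (Fin n) ℝ)
      (B : Matrix (Fin r) (Fin r) ℝ) (L : Matrix (Fin r) (Fin p) ℝ),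
      Q * P = 1 ∧ A * P = P * B ∧ K = P * L := by
  set W := Submodule.span ℝ {v : Fin n → ℝ | ∃ k < n, ∃ j : Fin p, v = (A ^ k * K)ᵀ j}
  have hr : Module.finrank ℝ W < n := by
    simpa using Submodule.finrank_lt h
  let e := (Module.finBasis ℝ W).equivFun
  let f : (Fin (Module.finrank ℝ W) → ℝ) →ₗ[ℝ] (Fin n → ℝ) := W.subtype ∘ₗ e.symm.toLinearMap
  have hf : LinearMap.ker f = ⊥ :=
    LinearMap.ker_eq_bot.2 (W.injective_subtype.comp e.symm.injective)
  obtain ⟨g, hg⟩ := f.exists_leftInverse_of_injective hf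
  have hQP : g.toMatrix' * f.toMatrix' = 1 := by
    rw [← LinearMap.toMatrix'_comp, hg, LinearMap.toMatrix'_id]
  have hproj : ∀ {q : ℕ} (M : Matrix (Fin n) (Fin q) ℝ), (∀ j, Mᵀ j ∈ W) →
      M = f.toMatrix' * (g.toMatrix' * M) := by
    intro q M hM
    apply Matrix.transpose_injective
    funext j
    change Mᵀ j = f.toMatrix' *ᵥ (g.toMatrix' *ᵥ Mᵀ j)
    rw [LinearMap.toMatrix'_mulVec, LinearMap.toMatrix'_mulVec]
    have hfe : f (e ⟨Mᵀ j, hM j⟩) = Mᵀ j := by simp [f]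
    rw [← hfe, ← LinearMap.comp_apply g f, hg, LinearMap.id_apply]
  have hinv : ∀ v ∈ W, A *ᵥ v ∈ W := by
    intro v hv
    suffices W ≤ W.comap A.mulVecLin from this hv
    refine Submodule.span_le.2 ?_
    rintro _ ⟨k, -, j, rfl⟩
    change A *ᵥ (A ^ k * K)ᵀ j ∈ W
    have := pow_mul_col_mem_span A K (k + 1) j
    rwa [pow_succ', Matrix.mul_assoc] at this
  refine ⟨_, hr, f.toMatrix', g.toMatrix', _, _, hQP, hproj _ fun j => hinv _ ?_,
    hproj _ fun j => ?_⟩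
  swap
  · have := pow_mul_col_mem_span A K 0 j
    rwa [pow_zero, Matrix.one_mul] at this
  have hcol : f.toMatrix'ᵀ j = f (Pi.single j 1) := by
    ext i
    simp [LinearMap.toMatrix'_apply]
  change f.toMatrix'ᵀ j ∈ W
  rw [hcol]
  exact (e.symm _).2

/-- An uncontrollable stable tuple admits a smaller stable tuple with the same Markov parameters. -/
theorem exists_smaller_tuple_of_not_controllable {n p : ℕ} {A : Matrix (Fin n) (Fin n) ℝ}
    {K : Matrix (Fin n) (Fin p) ℝ} {C : Matrix (Fin p) (Fin n) ℝ}
    (hA : SchurStable A) (hAKC : SchurStable (A - K * C)) (h : ¬ Controllable A K) :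
    ∃ r < n, ∃ (B : Matrix (Fin r) (Fin r) ℝ) (L : Matrix (Fin r) (Fin p) ℝ)
      (D : Matrix (Fin p) (Fin r) ℝ), SchurStable B ∧ SchurStable (B - L * D) ∧
      ∀ k : ℕ, D * (B - L * D) ^ k * L = C * (A - K * C) ^ k * K := by
  obtain ⟨r, hr, P, Q, B, L, hQP, hAP, rfl⟩ := exists_restriction_of_not_controllable h
  have hcl : (A - P * L * C) * P = P * (B - L * (C * P)) := by
    rw [Matrix.sub_mul, Matrix.mul_sub, hAP]
    simp only [Matrix.mul_assoc]
  have hpow : ∀ k : ℕ, (A - P * L * C) ^ k * P = P * (B - L * (C * P)) ^ k := by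
    intro k
    induction k with
    | zero => simp
    | succ k ih => rw [pow_succ, Matrix.mul_assoc, hcl, ← Matrix.mul_assoc, ih, Matrix.mul_assoc,
        ← pow_succ]
  refine ⟨r, hr, B, L, C * P, hA.of_intertwining hQP hAP, hAKC.of_intertwining hQP hcl,
    fun k => ?_⟩
  rw [Matrix.mul_assoc C P, ← hpow]
  simp only [Matrix.mul_assoc]

theorem Controllable.observable_of_transpose {n p : ℕ} {A : Matrix (Fin n) (Fin n) ℝ}
    {C : Matrix (Fin p) (Fin n) ℝ} (h : Controllable Aᵀ Cᵀ) : Observable C A := by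
  intro x hx
  have hle : (⊤ : Submodule ℝ (Fin n → ℝ)) ≤ LinearMap.ker (dotProductBilin ℝ ℝ x) := by
    rw [← h, Submodule.span_le]
    rintro _ ⟨k, hk, j, rfl⟩
    change x ⬝ᵥ (Aᵀ ^ k * Cᵀ)ᵀ j = 0
    rw [← Matrix.transpose_pow, ← Matrix.transpose_mul, Matrix.transpose_transpose,
      dotProduct_comm]
    exact congrFun (hx k hk) j
  exact dotProduct_self_eq_zero.1 (hle (Submodule.mem_top (x := x)))

/-- An unobservable stable tuple admits a smaller stable tuple with the same Markov parameters. -/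
theorem exists_smaller_tuple_of_not_observable {n p : ℕ} {A : Matrix (Fin n) (Fin n) ℝ}
    {K : Matrix (Fin n) (Fin p) ℝ} {C : Matrix (Fin p) (Fin n) ℝ}
    (hA : SchurStable A) (hAKC : SchurStable (A - K * C)) (h : ¬ Observable C A) :
    ∃ r < n, ∃ (B : Matrix (Fin r) (Fin r) ℝ) (L : Matrix (Fin r) (Fin p) ℝ)
      (D : Matrix (Fin p) (Fin r) ℝ), SchurStable B ∧ SchurStable (B - L * D) ∧
      ∀ k : ℕ, D * (B - L * D) ^ k * L = C * (A - K * C) ^ k * K := by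
  obtain ⟨r, hr, B, L, D, hB, hBLD, hM⟩ := exists_smaller_tuple_of_not_controllable
    (C := Kᵀ) hA.transpose (by simpa [Matrix.transpose_sub] using hAKC.transpose)
    (mt Controllable.observable_of_transpose h)
  refine ⟨r, hr, Bᵀ, Dᵀ, Lᵀ, hB.transpose, by simpa [Matrix.transpose_sub] using hBLD.transpose,
    fun k => Matrix.transpose_injective ?_⟩
  simpa [Matrix.transpose_mul, Matrix.transpose_pow, Matrix.transpose_sub, Matrix.mul_assoc]
    using hM k

/-- Existence of a minimal tuple: any tuple `(Â, K̂, Ĉ)` with `Â` and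
`Â − K̂Ĉ` Schur stable admits a minimal tuple `(A_m, K_m, C_m)` of dimension
`m ≤ n` with the same Markov parameters
`C_m(A_m−K_mC_m)^{k−1}K_m = Ĉ(Â−K̂Ĉ)^{k−1}K̂` for all `k ≥ 1`. -/
theorem exists_minimal_tuple {n p : ℕ}
    (Ahat : Matrix (Fin n) (Fin n) ℝ) (Khat : Matrix (Fin n) (Fin p) ℝ)
    (Chat : Matrix (Fin p) (Fin n) ℝ)
    (hA : SchurStable Ahat) (hAKC : SchurStable (Ahat - Khat * Chat)) :
    ∃ m ≤ n, ∃ (Am : Matrix (Fin m) (Fin m) ℝ) (Km : Matrix (Fin m) (Fin p) ℝ)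
      (Cm : Matrix (Fin p) (Fin m) ℝ),
      MinimalTuple Am Km Cm ∧
      ∀ k : ℕ, 1 ≤ k →
        Cm * (Am - Km * Cm) ^ (k - 1) * Km
          = Chat * (Ahat - Khat * Chat) ^ (k - 1) * Khat := by
  induction n using Nat.strong_induction_on with
  | _ n ih =>
    by_cases hmin : Controllable Ahat Khat ∧ Observable Chat Ahat
    · exact ⟨n, le_rfl, Ahat, Khat, Chat, ⟨hmin.1, hmin.2, hA, hAKC⟩, fun _ _ => rfl⟩
    obtain ⟨r, hr, B, L, D, hB, hBLD, hM⟩ : ∃ r < n, ∃ (B : Matrix (Fin r) (Fin r) ℝ)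
        (L : Matrix (Fin r) (Fin p) ℝ) (D : Matrix (Fin p) (Fin r) ℝ),
        SchurStable B ∧ SchurStable (B - L * D) ∧
        ∀ k : ℕ, D * (B - L * D) ^ k * L = Chat * (Ahat - Khat * Chat) ^ k * Khat := by
      rcases not_and_or.1 hmin with h | h
      · exact exists_smaller_tuple_of_not_controllable hA hAKC h
      · exact exists_smaller_tuple_of_not_observable hA hAKC h
    obtain ⟨m, hm, Am, Km, Cm, hmin', hM'⟩ := ih r hr B L D hB hBLD
    exact ⟨m, hm.trans hr.le, Am, Km, Cm, hmin', fun k hk => (hM' k hk).trans (hM _)⟩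
end

section
/- Uniqueness of minimal tuples up to isomorphism (Lemma, part 2): let (A,K,C) with A ∈ ℝ^{n×n}, K ∈ ℝ^{n×p}, C ∈ ℝ^{p×n} and (A',K',C') with A' ∈ ℝ^{n'×n'}, K' ∈ ℝ^{n'×p}, C' ∈ ℝ^{p×n'} both be minimal tuples, and suppose their Markov parameters coincide: for all k ≥ 1, C(A−KC)^{k−1}K = C'(A'−K'C')^{k−1}K'. Then n = n' and there exists an invertible matrix T ∈ ℝ^{n×n} such that A' = T A T^{−1}, K' = T K and C' = C T^{−1}. -/
open Matrix

theorem mul_pow_mul_pow_mul_eq_of_markov {n n' p : ℕ}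
    {A : Matrix (Fin n) (Fin n) ℝ} {K : Matrix (Fin n) (Fin p) ℝ}
    {C : Matrix (Fin p) (Fin n) ℝ}
    {A' : Matrix (Fin n') (Fin n') ℝ} {K' : Matrix (Fin n') (Fin p) ℝ}
    {C' : Matrix (Fin p) (Fin n') ℝ}
    (h : ∀ j : ℕ, C * (A - K * C) ^ j * K = C' * (A' - K' * C') ^ j * K') (k j : ℕ) :
    C * (A - K * C) ^ j * A ^ k * K = C' * (A' - K' * C') ^ j * A' ^ k * K' := by
  have step {m : ℕ} (A : Matrix (Fin m) (Fin m) ℝ) (K : Matrix (Fin m) (Fin p) ℝ)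
      (C : Matrix (Fin p) (Fin m) ℝ) (j k : ℕ) :
      C * (A - K * C) ^ j * A ^ (k + 1) * K =
        C * (A - K * C) ^ (j + 1) * A ^ k * K +
          (C * (A - K * C) ^ j * K) * (C * (A - K * C) ^ 0 * A ^ k * K) := by
    have hA : A ^ (k + 1) = (A - K * C) * A ^ k + K * C * A ^ k := by
      rw [← add_mul, sub_add_cancel, pow_succ']
    rw [hA, pow_succ (A - K * C) j]
    simp only [pow_zero, Matrix.mul_one, Matrix.mul_add, Matrix.add_mul, Matrix.mul_assoc]
  induction k generalizing j with
  | zero => simpa using h j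
  | succ k ih => rw [step, step, ih, ih, h]

theorem mul_pow_mul_eq_of_markov {n n' p : ℕ}
    {A : Matrix (Fin n) (Fin n) ℝ} {K : Matrix (Fin n) (Fin p) ℝ}
    {C : Matrix (Fin p) (Fin n) ℝ}
    {A' : Matrix (Fin n') (Fin n') ℝ} {K' : Matrix (Fin n') (Fin p) ℝ}
    {C' : Matrix (Fin p) (Fin n') ℝ}
    (h : ∀ j : ℕ, C * (A - K * C) ^ j * K = C' * (A' - K' * C') ^ j * K') (k : ℕ) :
    C * A ^ k * K = C' * A' ^ k * K' := by
  simpa using mul_pow_mul_pow_mul_eq_of_markov h k 0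

/-- The observability map of `(C, A)`, sending a state `x` to the outputs `C A ^ k x`. -/
def observabilityMap {n p : ℕ} (C : Matrix (Fin p) (Fin n) ℝ)
    (A : Matrix (Fin n) (Fin n) ℝ) : (Fin n → ℝ) →ₗ[ℝ] (ℕ → Fin p → ℝ) :=
  LinearMap.pi fun k => (C * A ^ k).mulVecLin

@[simp]
theorem observabilityMap_apply {n p : ℕ} (C : Matrix (Fin p) (Fin n) ℝ)
    (A : Matrix (Fin n) (Fin n) ℝ) (x : Fin n → ℝ) (k : ℕ) :
    observabilityMap C A x k = (C * A ^ k) *ᵥ x := rfl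

theorem observabilityMap_mulVec {n p : ℕ} (C : Matrix (Fin p) (Fin n) ℝ)
    (A : Matrix (Fin n) (Fin n) ℝ) (x : Fin n → ℝ) (k : ℕ) :
    observabilityMap C A (A *ᵥ x) k = observabilityMap C A x (k + 1) := by
  simp [Matrix.mulVec_mulVec, pow_succ, Matrix.mul_assoc]

theorem Observable.injective {n p : ℕ} {C : Matrix (Fin p) (Fin n) ℝ}
    {A : Matrix (Fin n) (Fin n) ℝ} (h : Observable C A) :
    Function.Injective (observabilityMap C A) :=
  (injective_iff_map_eq_zero _).2 fun x hx => h x fun k _ => congrFun hx k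

theorem observabilityMap_col_eq {n n' p : ℕ}
    {A : Matrix (Fin n) (Fin n) ℝ} {K : Matrix (Fin n) (Fin p) ℝ}
    {C : Matrix (Fin p) (Fin n) ℝ}
    {A' : Matrix (Fin n') (Fin n') ℝ} {K' : Matrix (Fin n') (Fin p) ℝ}
    {C' : Matrix (Fin p) (Fin n') ℝ}
    (h : ∀ k : ℕ, C * A ^ k * K = C' * A' ^ k * K') (k : ℕ) (j : Fin p) :
    observabilityMap C A ((A ^ k * K)ᵀ j) = observabilityMap C' A' ((A' ^ k * K')ᵀ j) := by
  have col {m : ℕ} (A : Matrix (Fin m) (Fin m) ℝ) (K : Matrix (Fin m) (Fin p) ℝ)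
      (C : Matrix (Fin p) (Fin m) ℝ) (l : ℕ) :
      (C * A ^ l) *ᵥ (A ^ k * K)ᵀ j = (C * A ^ (l + k) * K)ᵀ j := by
    rw [pow_add, ← Matrix.mul_assoc, Matrix.mul_assoc (C * A ^ l)]
    rfl
  funext l
  simp only [observabilityMap_apply, col, h]

theorem Controllable.range_observabilityMap_le {n n' p : ℕ}
    {A : Matrix (Fin n) (Fin n) ℝ} {K : Matrix (Fin n) (Fin p) ℝ}
    {C : Matrix (Fin p) (Fin n) ℝ}
    {A' : Matrix (Fin n') (Fin n') ℝ} {K' : Matrix (Fin n') (Fin p) ℝ}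
    {C' : Matrix (Fin p) (Fin n') ℝ} (hc : Controllable A K)
    (h : ∀ k : ℕ, C * A ^ k * K = C' * A' ^ k * K') :
    LinearMap.range (observabilityMap C A) ≤ LinearMap.range (observabilityMap C' A') := by
  rw [LinearMap.range_eq_map, ← hc, Submodule.map_span_le]
  rintro _ ⟨k, -, j, rfl⟩
  exact ⟨_, (observabilityMap_col_eq h k j).symm⟩

/-- Uniqueness of minimal tuples up to isomorphism: two minimal tuples with
the same Markov parameters have the same dimension and are related by a
(linear isomorphism) change of basis `T`: `A' = T A T⁻¹`, `K' = T K`,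
`C' = C T⁻¹`, where `T'` plays the role of `T⁻¹`. -/
theorem minimal_tuple_unique_up_to_iso {n n' p : ℕ}
    (A : Matrix (Fin n) (Fin n) ℝ) (K : Matrix (Fin n) (Fin p) ℝ)
    (C : Matrix (Fin p) (Fin n) ℝ)
    (A' : Matrix (Fin n') (Fin n') ℝ) (K' : Matrix (Fin n') (Fin p) ℝ)
    (C' : Matrix (Fin p) (Fin n') ℝ)
    (hmin : MinimalTuple A K C) (hmin' : MinimalTuple A' K' C')
    (hMarkov : ∀ k : ℕ, 1 ≤ k →
      C * (A - K * C) ^ (k - 1) * K = C' * (A' - K' * C') ^ (k - 1) * K') :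
    n = n' ∧ ∃ (T : Matrix (Fin n') (Fin n) ℝ) (T' : Matrix (Fin n) (Fin n') ℝ),
      T * T' = 1 ∧ T' * T = 1 ∧
      A' = T * A * T' ∧ K' = T * K ∧ C' = C * T' := by
  obtain ⟨hc, ho, -, -⟩ := hmin
  obtain ⟨hc', ho', -, -⟩ := hmin'
  have h : ∀ k : ℕ, C * A ^ k * K = C' * A' ^ k * K' :=
    mul_pow_mul_eq_of_markov fun j => by simpa using hMarkov (j + 1) (Nat.le_add_left 1 j)
  have hrange : LinearMap.range (observabilityMap C A) =
      LinearMap.range (observabilityMap C' A') :=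
    (hc.range_observabilityMap_le h).antisymm
      (hc'.range_observabilityMap_le fun k => (h k).symm)
  let e : (Fin n → ℝ) ≃ₗ[ℝ] (Fin n' → ℝ) :=
    LinearEquiv.ofInjective _ ho.injective ≪≫ₗ LinearEquiv.ofEq _ _ hrange ≪≫ₗ
      (LinearEquiv.ofInjective _ ho'.injective).symm
  have he (x : Fin n → ℝ) : observabilityMap C' A' (e x) = observabilityMap C A x :=
    congrArg Subtype.val ((LinearEquiv.ofInjective _ ho'.injective).apply_symm_apply
      (LinearEquiv.ofEq _ _ hrange (LinearEquiv.ofInjective _ ho.injective x)))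
  let T := LinearMap.toMatrix' e.toLinearMap
  let T' := LinearMap.toMatrix' e.symm.toLinearMap
  have hT (x : Fin n → ℝ) : T *ᵥ x = e x := LinearMap.toMatrix'_mulVec _ x
  have hTT' : T * T' = 1 := by
    rw [← LinearMap.toMatrix'_comp, LinearEquiv.comp_symm, LinearMap.toMatrix'_id]
  have hT'T : T' * T = 1 := by
    rw [← LinearMap.toMatrix'_comp, LinearEquiv.symm_comp, LinearMap.toMatrix'_id]
  have hTA : T * A = A' * T := by
    refine Matrix.ext_of_mulVec_single fun i => ho'.injective (funext fun k => ?_)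
    rw [← Matrix.mulVec_mulVec, ← Matrix.mulVec_mulVec, hT, hT, he,
      observabilityMap_mulVec, observabilityMap_mulVec, he]
  have hTK : K' = T * K := by
    refine Matrix.transpose_injective (funext fun j => ho'.injective ?_)
    have hcol : (T * K)ᵀ j = e (Kᵀ j) := hT (Kᵀ j)
    rw [hcol, he]
    simpa using (observabilityMap_col_eq h 0 j).symm
  have hCT : C' * T = C := by
    refine Matrix.ext_of_mulVec_single fun i => ?_
    rw [← Matrix.mulVec_mulVec, hT]
    simpa using congrFun (he (Pi.single i 1)) 0
  refine ⟨by simpa using e.finrank_eq, T, T', hTT', hT'T, ?_, hTK, ?_⟩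
  · rw [hTA, Matrix.mul_assoc, hTT', Matrix.mul_one]
  · rw [← hCT, Matrix.mul_assoc, hTT', Matrix.mul_one]
end

section
/- Inverse of the block-Toeplitz unitriangular matrix built from the Markov parameters: let A ∈ ℝ^{n×n}, K ∈ ℝ^{n×p}, C ∈ ℝ^{p×n}, set F = A − KC, and fix N ≥ 1. Define the block matrices L, M ∈ ℝ^{pN×pN}, each consisting of N×N blocks of size p×p, by: the (i,j) block of L is the identity I_p if i = j, equals −C F^{i−j−1} K if i > j, and is 0 if i < j; the (i,j) block of M is I_p if i = j, equals C A^{i−j−1} K if i > j, and is 0 if i < j. Then L·M = I_{pN} and M·L = I_{pN}, i.e. M = L^{−1}. -/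
open Matrix

theorem sum_antidiagonal_pow_mul_sub_mul_pow {R : Type*} [Ring R] (x y : R) (e : ℕ) :
    ∑ q ∈ Finset.HasAntidiagonal.antidiagonal e, x ^ q.1 * (y - x) * y ^ q.2 = y ^ (e + 1) - x ^ (e + 1) := by
  induction e with
  | zero => simp
  | succ e ih =>
    rw [Finset.Nat.sum_antidiagonal_succ']
    simp only [pow_succ y, ← mul_assoc] at ih ⊢
    rw [← Finset.sum_mul, ih]
    simp only [pow_zero, pow_succ]
    noncomm_ring

/-- The Markov parameters of `(A, K, C)`, preceded by the identity. -/
def markovSeq {n p R : Type*} [Fintype n] [DecidableEq n] [DecidableEq p] [Ring R]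
    (A : Matrix n n R) (K : Matrix n p R) (C : Matrix p n R) : ℕ → Matrix p p R
  | 0 => 1
  | k + 1 => C * A ^ k * K

theorem sum_antidiagonal_markovSeq {n p R : Type*} [Fintype n] [DecidableEq n] [Fintype p]
    [DecidableEq p] [Ring R] (A : Matrix n n R) (K : Matrix n p R) (C : Matrix p n R) (d : ℕ) :
    ∑ q ∈ Finset.HasAntidiagonal.antidiagonal d, markovSeq (A - K * C) K (-C) q.1 * markovSeq A K C q.2 =
      if d = 0 then 1 else 0 := by
  rcases d with _ | _ | d
  · simp [markovSeq]
  · simp [markovSeq, Finset.Nat.sum_antidiagonal_succ]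
  · have h := sum_antidiagonal_pow_mul_sub_mul_pow (A - K * C) A d
    rw [sub_sub_cancel] at h
    rw [Finset.Nat.sum_antidiagonal_succ, Finset.Nat.sum_antidiagonal_succ']
    have hs : ∑ q ∈ Finset.HasAntidiagonal.antidiagonal d,
        markovSeq (A - K * C) K (-C) (q.1 + 1) * markovSeq A K C (q.2 + 1) =
        -(C * (∑ q ∈ Finset.HasAntidiagonal.antidiagonal d, (A - K * C) ^ q.1 * (K * C) * A ^ q.2) * K) := by
      rw [Matrix.mul_sum, Matrix.sum_mul, ← Finset.sum_neg_distrib]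
      refine Finset.sum_congr rfl fun q _ => ?_
      simp [markovSeq, Matrix.mul_assoc]
    rw [hs, h]
    simp only [markovSeq, Matrix.one_mul, Matrix.mul_one, Matrix.mul_sub, Matrix.sub_mul, Matrix.neg_mul,
      neg_sub, Nat.add_eq_zero_iff, one_ne_zero, and_false, if_false]
    abel

/-- The product of two lower-triangular Toeplitz matrices is given by convolution. -/
theorem sum_lowerToeplitz_mul {R : Type*} [Semiring R] {N : ℕ} (f g : ℕ → R) (i j : Fin N) :
    ∑ k : Fin N, (if k ≤ i then f ((i : ℕ) - k) else 0) * (if j ≤ k then g ((k : ℕ) - j) else 0) =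
      if j ≤ i then ∑ q ∈ Finset.HasAntidiagonal.antidiagonal ((i : ℕ) - j), f q.1 * g q.2 else 0 := by
  split_ifs with hij
  · simp only [ite_mul, mul_ite, zero_mul, mul_zero, ← ite_and]
    rw [← Finset.sum_filter]
    refine Finset.sum_bij (fun k _ => ((i : ℕ) - k, (k : ℕ) - j)) ?_ ?_ ?_ ?_
    · intro k hk
      simp only [Finset.mem_filter, Finset.mem_univ, true_and, Fin.le_def] at hk
      simp only [Finset.HasAntidiagonal.mem_antidiagonal]
      omega
    · intro k hk l hl h
      simp only [Finset.mem_filter, Finset.mem_univ, true_and, Fin.le_def] at hk hl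
      simp only [Prod.mk.injEq] at h
      ext
      omega
    · rintro ⟨a, b⟩ h
      rw [Finset.HasAntidiagonal.mem_antidiagonal] at h
      rw [Fin.le_def] at hij
      refine ⟨⟨j + b, by omega⟩, ?_, ?_⟩
      · simp only [Finset.mem_filter, Finset.mem_univ, true_and, Fin.le_def]
        omega
      · ext <;> simp only <;> omega
    · intro k _
      rfl
  · refine Finset.sum_eq_zero fun k _ => ?_
    by_cases h : k ≤ i
    · rw [if_neg (fun hjk : j ≤ k => hij (hjk.trans h)), mul_zero]
    · rw [if_neg h, zero_mul]

theorem markovSeq_sub_apply {n p R : Type*} [Fintype n] [DecidableEq n] [DecidableEq p] [Ring R]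
    {N : ℕ} (A : Matrix n n R) (K : Matrix n p R) (C : Matrix p n R) (i j : Fin N) (a b : p) :
    (if j ≤ i then markovSeq A K C ((i : ℕ) - j) else 0) a b =
      if i = j then (if a = b then (1 : R) else 0)
      else if j < i then (C * A ^ ((i : ℕ) - (j : ℕ) - 1) * K) a b
      else 0 := by
  rcases lt_trichotomy i j with h | rfl | h
  · simp [h.ne, h.not_gt, h.not_ge]
  · simp [markovSeq, Matrix.one_apply]
  · obtain ⟨d, hd⟩ : ∃ d, (i : ℕ) - j = d + 1 := ⟨i - j - 1, by rw [Fin.lt_def] at h; omega⟩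
    simp [h.ne', h, h.le, hd, markovSeq]

/-- Inverse of the block-Toeplitz unitriangular matrix built from the Markov
parameters: with `F = A − KC`, the block lower-triangular matrix `L` with
identity diagonal blocks and `(i,j)` block `−C F^{i−j−1} K` for `i > j`, and
the matrix `M` with identity diagonal blocks and `(i,j)` block `C A^{i−j−1} K`
for `i > j`, satisfy `L·M = I` and `M·L = I`, i.e. `M = L⁻¹`. -/
theorem blockToeplitz_inverse {n p N : ℕ} (hN : 1 ≤ N)
    (A : Matrix (Fin n) (Fin n) ℝ) (K : Matrix (Fin n) (Fin p) ℝ)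
    (C : Matrix (Fin p) (Fin n) ℝ)
    (F : Matrix (Fin n) (Fin n) ℝ) (hF : F = A - K * C)
    (L M : Matrix (Fin N × Fin p) (Fin N × Fin p) ℝ)
    (hL : ∀ (i j : Fin N) (a b : Fin p),
      L (i, a) (j, b) =
        if i = j then (if a = b then (1 : ℝ) else 0)
        else if j < i then -((C * F ^ ((i : ℕ) - (j : ℕ) - 1) * K) a b)
        else 0)
    (hM : ∀ (i j : Fin N) (a b : Fin p),
      M (i, a) (j, b) =
        if i = j then (if a = b then (1 : ℝ) else 0)
        else if j < i then (C * A ^ ((i : ℕ) - (j : ℕ) - 1) * K) a b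
        else 0) :
    L * M = 1 ∧ M * L = 1 := by
  have hL' (i j : Fin N) (a b : Fin p) :
      L (i, a) (j, b) = (if j ≤ i then markovSeq F K (-C) ((i : ℕ) - j) else 0) a b := by
    rw [markovSeq_sub_apply, hL]
    simp only [Matrix.neg_mul, Matrix.neg_apply]
  have hM' (i j : Fin N) (a b : Fin p) :
      M (i, a) (j, b) = (if j ≤ i then markovSeq A K C ((i : ℕ) - j) else 0) a b := by
    rw [markovSeq_sub_apply, hM]
  have hLM : L * M = 1 := by
    ext ⟨i, a⟩ ⟨j, b⟩
    have h := sum_lowerToeplitz_mul (markovSeq F K (-C)) (markovSeq A K C) i j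
    rw [hF, sum_antidiagonal_markovSeq, ← hF] at h
    have hab := congrFun (congrFun h a) b
    rw [Matrix.sum_apply] at hab
    rw [Matrix.mul_apply, Fintype.sum_prod_type]
    simp only [hL', hM', ← Matrix.mul_apply]
    rw [hab]
    rcases lt_trichotomy i j with h | rfl | h
    · simp [h.ne, h.not_ge]
    · simp [Matrix.one_apply]
    · have hne : (i : ℕ) - j ≠ 0 := by
        rw [Fin.lt_def] at h
        omega
      rw [if_pos h.le, if_neg hne]
      simp [h.ne']
  exact ⟨hLM, mul_eq_one_comm.mp hLM⟩
end

section
/- Asymptotic sandwich for the upper-bound term (Lemma): let (Θ,B,π) be a probability space, p ≥ 1 an integer, λ > 0, and let ρ₀ ≥ μ > 0 be constants. Let v : Θ → ℝ be measurable with θ ↦ exp(λ v(θ)) π-integrable, and let ρ : ℕ → Θ → ℝ be measurable functions such that for every θ the sequence N ↦ ρ_N(θ) is non-increasing and satisfies μ ≤ ρ_N(θ) ≤ ρ₀ for all N ≥ 1. Define u_N = log ∫_Θ exp(λ v(θ)) / (1 + 2λρ_N(θ)/N)^{pN/2} dπ(θ). Then the limit lim_{N→∞} u_N exists and satisfies log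 ∫_Θ exp(λ(v(θ) − pρ₀)) dπ(θ) ≤ lim_{N→∞} u_N ≤ log ∫_Θ exp(λ(v(θ) − pμ)) dπ(θ). -/
open MeasureTheory Filter

/-- The exponential limit `(1 + 2 c xₙ / n) ^ (a n / 2) → exp (a c x)` along a convergent
sequence `xₙ → x`. -/
theorem tendsto_one_add_div_rpow_exp_of_tendsto {x : ℕ → ℝ} {y : ℝ} (a : ℝ) {c : ℝ} (hc : 0 ≤ c)
    (hx : Tendsto x atTop (nhds y)) (hx0 : ∀ᶠ n in atTop, 0 ≤ x n) :
    Tendsto (fun n : ℕ => (1 + 2 * c * x n / n) ^ (a * n / 2)) atTop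
      (nhds (Real.exp (a * c * y))) := by
  have h1 : Tendsto (fun n : ℕ => (n : ℝ) * (2 * c * x n / n)) atTop (nhds (2 * c * y)) := by
    refine (hx.const_mul (2 * c)).congr' ?_
    filter_upwards [eventually_ne_atTop 0] with n hn
    field_simp
  have h2 := (Real.tendsto_one_add_pow_exp_of_tendsto h1).rpow_const (p := a / 2)
    (Or.inl (Real.exp_ne_zero _))
  rw [← Real.exp_mul, show 2 * c * y * (a / 2) = a * c * y by ring] at h2
  refine h2.congr' ?_
  filter_upwards [hx0] with n hn
  rw [← Real.rpow_natCast, ← Real.rpow_mul (by positivity)]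
  ring_nf

/-- Asymptotic sandwich for the upper-bound term: with `pri` a probability
measure on `Θ`, `λ > 0`, `p ≥ 1`, `ρ₀ ≥ μ > 0`, `v` measurable with
`exp(λ v)` integrable, and measurable `ρ N : Θ → ℝ` non-increasing in `N` with
`μ ≤ ρ N θ ≤ ρ₀` for `N ≥ 1`, the sequence
`u N = log ∫ exp(λ v θ) / (1 + 2λ ρ N θ / N)^(pN/2) d pri` converges and its
limit lies between `log ∫ exp(λ(v − pρ₀)) d pri` and
`log ∫ exp(λ(v − pμ)) d pri`. -/
theorem upper_bound_term_sandwich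
    {Θ : Type*} [MeasurableSpace Θ] (pri : Measure Θ) [IsProbabilityMeasure pri]
    (p : ℕ) (hp : 1 ≤ p) (lam : ℝ) (hlam : 0 < lam)
    (ρ₀ μ : ℝ) (hμ : 0 < μ) (hρ₀ : μ ≤ ρ₀)
    (v : Θ → ℝ) (hv : Measurable v)
    (hvint : Integrable (fun θ => Real.exp (lam * v θ)) pri)
    (ρ : ℕ → Θ → ℝ) (hρmeas : ∀ N, Measurable (ρ N))
    (hρanti : ∀ θ, ∀ N M : ℕ, 1 ≤ N → N ≤ M → ρ M θ ≤ ρ N θ)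
    (hρbound : ∀ θ, ∀ N : ℕ, 1 ≤ N → μ ≤ ρ N θ ∧ ρ N θ ≤ ρ₀)
    (u : ℕ → ℝ)
    (hu : ∀ N : ℕ, u N = Real.log (∫ θ,
      Real.exp (lam * v θ)
        / (1 + 2 * lam * ρ N θ / N) ^ ((p : ℝ) * N / 2) ∂pri)) :
    ∃ l : ℝ, Tendsto u atTop (nhds l) ∧
      Real.log (∫ θ, Real.exp (lam * (v θ - p * ρ₀)) ∂pri) ≤ l ∧
      l ≤ Real.log (∫ θ, Real.exp (lam * (v θ - p * μ)) ∂pri) := by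
  have hconv : ∀ θ, ∃ r, Tendsto (fun N => ρ N θ) atTop (nhds r) := fun θ => by
    have hanti : Antitone fun N => ρ (N + 1) θ := fun N M h =>
      hρanti θ (N + 1) (M + 1) (by omega) (by omega)
    have hbdd : BddBelow (Set.range fun N => ρ (N + 1) θ) :=
      ⟨μ, by rintro _ ⟨N, rfl⟩; exact (hρbound θ (N + 1) (by omega)).1⟩
    exact ⟨_, (tendsto_add_atTop_iff_nat 1).1 (tendsto_atTop_ciInf hanti hbdd)⟩
  choose r hr using hconv
  have hrmeas : Measurable r := measurable_of_tendsto_metrizable hρmeas (tendsto_pi_nhds.2 hr)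
  have hμr : ∀ θ, μ ≤ r θ := fun θ => ge_of_tendsto (hr θ) <| by
    filter_upwards [eventually_ge_atTop 1] with N hN using (hρbound θ N hN).1
  have hrρ₀ : ∀ θ, r θ ≤ ρ₀ := fun θ => le_of_tendsto (hr θ) <| by
    filter_upwards [eventually_ge_atTop 1] with N hN using (hρbound θ N hN).2
  have hint : ∀ s : Θ → ℝ, Measurable s → (∀ θ, 0 ≤ s θ) →
      Integrable (fun θ => Real.exp (lam * (v θ - p * s θ))) pri := fun s hs hs0 => by
    refine hvint.mono' (by fun_prop) (ae_of_all _ fun θ => ?_)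
    rw [Real.norm_eq_abs, Real.abs_exp]
    have := hs0 θ
    gcongr
    exact sub_le_self _ (by positivity)
  have hint_r := hint r hrmeas fun θ => hμ.le.trans (hμr θ)
  have hint_μ := hint (fun _ => μ) measurable_const fun _ => hμ.le
  have hint_ρ₀ := hint (fun _ => ρ₀) measurable_const fun _ => hμ.le.trans hρ₀
  have hpos_r := integral_exp_pos hint_r
  have hlim : Tendsto (fun N : ℕ => ∫ θ, Real.exp (lam * v θ)
      / (1 + 2 * lam * ρ N θ / N) ^ ((p : ℝ) * N / 2) ∂pri) atTop
      (nhds (∫ θ, Real.exp (lam * (v θ - p * r θ)) ∂pri)) := by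
    refine tendsto_integral_filter_of_dominated_convergence _
      (Eventually.of_forall fun N => ?_) ?_ hvint (ae_of_all _ fun θ => ?_)
    · have := hρmeas N
      exact Measurable.aestronglyMeasurable (by fun_prop)
    · filter_upwards [eventually_ge_atTop 1] with N hN
      refine ae_of_all _ fun θ => ?_
      have hρ0 : 0 ≤ ρ N θ := hμ.le.trans (hρbound θ N hN).1
      have hbase : 1 ≤ 1 + 2 * lam * ρ N θ / N := le_add_of_nonneg_right (by positivity)
      rw [Real.norm_of_nonneg (by positivity)]
      exact div_le_self (Real.exp_pos _).le (Real.one_le_rpow hbase (by positivity))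
    · have h := tendsto_one_add_div_rpow_exp_of_tendsto (p : ℝ) hlam.le (hr θ) <| by
        filter_upwards [eventually_ge_atTop 1] with N hN using hμ.le.trans (hρbound θ N hN).1
      have h' := (tendsto_const_nhds (x := Real.exp (lam * v θ))).div h (Real.exp_ne_zero _)
      rwa [← Real.exp_sub, show lam * v θ - p * lam * r θ = lam * (v θ - p * r θ) by ring] at h'
  refine ⟨Real.log (∫ θ, Real.exp (lam * (v θ - p * r θ)) ∂pri), ?_, ?_, ?_⟩
  · rw [funext hu]
    exact hlim.log hpos_r.ne'
  · refine Real.log_le_log (integral_exp_pos hint_ρ₀) (integral_mono hint_ρ₀ hint_r fun θ => ?_)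
    have := hrρ₀ θ
    dsimp only
    gcongr
  · refine Real.log_le_log hpos_r (integral_mono hint_r hint_μ fun θ => ?_)
    have := hμr θ
    dsimp only
    gcongr
end

section
/- Equivalence of finite-past and infinite-past empirical losses (Lemma): let (Ω,F,P) be a probability space and y : ℤ → Ω → ℝ^p a stochastic process that is strictly stationary, square-integrable and zero-mean. Let (M_k)_{k≥1} be p×p real matrices with Σ_{k=1}^∞ ‖M_k‖ < ∞; for s < t let ŷ(t|s) = Σ_{k=1}^{t−s} M_k y(t−k), and let ŷ(t) denote the L²(P;ℝ^p) limit of ŷ(t|s) as s → −∞. Define the finite-past empirical loss L̂_N = (1/N) Σ_{t=1}^N ‖ŷ(t|0) − y(t)‖² and the infinite-past empirical loss V_N = (1/N) Σ_{t=1}^N ‖ŷ(t) − y(t)‖². Then E[ |L̂_N − V_N| ] → 0 as N → ∞, i.e. L̂_N − V_N converges to 0 in L¹(P). -/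
open MeasureTheory Filter

section LpNorm

variable {α E F : Type*} [MeasurableSpace α] {μ : Measure α}
  [NormedAddCommGroup E] [NormedAddCommGroup F]

theorem lpNorm_two_sq {f : α → E} (hf : AEStronglyMeasurable f μ) :
    lpNorm f 2 μ ^ 2 = ∫ x, ‖f x‖ ^ 2 ∂μ := by
  have h0 : 0 ≤ ∫ x, ‖f x‖ ^ 2 ∂μ := integral_nonneg fun x => by positivity
  rw [lpNorm_eq_integral_norm_rpow_toReal (by norm_num) (by norm_num) hf]
  simp only [ENNReal.toReal_ofNat, Real.rpow_ofNat]
  rw [← Real.rpow_natCast, ← Real.rpow_mul h0]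
  norm_num

theorem lpNorm_two_eq_sqrt {f : α → E} (hf : AEStronglyMeasurable f μ) :
    lpNorm f 2 μ = √(∫ x, ‖f x‖ ^ 2 ∂μ) := by
  rw [← lpNorm_two_sq hf, Real.sqrt_sq lpNorm_nonneg]

theorem lpNorm_comp_clm_le [NormedSpace ℝ E] [NormedSpace ℝ F] {p : ENNReal} (L : E →L[ℝ] F)
    {f : α → E} (hf : MemLp f p μ) :
    lpNorm (fun x => L (f x)) p μ ≤ ‖L‖ * lpNorm f p μ := by
  calc lpNorm (fun x => L (f x)) p μ ≤ lpNorm (‖L‖ • fun x => ‖f x‖) p μ :=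
        lpNorm_mono_real (hf.norm.const_smul ‖L‖) fun x => L.le_opNorm (f x)
    _ = ‖L‖ * lpNorm f p μ := by
        rw [lpNorm_const_smul, lpNorm_norm hf.aestronglyMeasurable]
        simp

theorem MeasureTheory.MemLp.integrable_norm_mul_norm {f : α → E} {g : α → F}
    (hf : MemLp f 2 μ) (hg : MemLp g 2 μ) : Integrable (fun x => ‖f x‖ * ‖g x‖) μ :=
  hf.norm.integrable_mul hg.norm

/-- Cauchy-Schwarz for the product of the norms of two square-integrable functions. -/
theorem integral_norm_mul_norm_le {f g : α → E} (hf : MemLp f 2 μ) (hg : MemLp g 2 μ) :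
    ∫ x, ‖f x‖ * ‖g x‖ ∂μ ≤ lpNorm f 2 μ * lpNorm g 2 μ := by
  have h := integral_mul_norm_le_Lp_mul_Lq (μ := μ) (f := f) (g := g) (p := 2) (q := 2)
    Real.HolderConjugate.two_two (by simpa using hf) (by simpa using hg)
  rw [lpNorm_two_eq_sqrt hf.aestronglyMeasurable, lpNorm_two_eq_sqrt hg.aestronglyMeasurable,
    Real.sqrt_eq_rpow, Real.sqrt_eq_rpow]
  simpa using h

theorem integrable_abs_norm_sq_sub_norm_sq {f g : α → E} (hf : MemLp f 2 μ) (hg : MemLp g 2 μ) :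
    Integrable (fun x => |‖f x‖ ^ 2 - ‖g x‖ ^ 2|) μ :=
  (((memLp_two_iff_integrable_sq_norm hf.aestronglyMeasurable).1 hf).sub
    ((memLp_two_iff_integrable_sq_norm hg.aestronglyMeasurable).1 hg)).abs

theorem integral_abs_norm_sq_sub_norm_sq_le {f g : α → E} (hf : MemLp f 2 μ) (hg : MemLp g 2 μ) :
    ∫ x, |‖f x‖ ^ 2 - ‖g x‖ ^ 2| ∂μ
      ≤ lpNorm (f - g) 2 μ * (lpNorm f 2 μ + lpNorm g 2 μ) := by
  have hfg := hf.sub hg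
  have h1 := hfg.integrable_norm_mul_norm hf
  have h2 := hfg.integrable_norm_mul_norm hg
  calc ∫ x, |‖f x‖ ^ 2 - ‖g x‖ ^ 2| ∂μ
      ≤ ∫ x, (‖(f - g) x‖ * ‖f x‖ + ‖(f - g) x‖ * ‖g x‖) ∂μ := by
        refine integral_mono (integrable_abs_norm_sq_sub_norm_sq hf hg) (h1.add h2) fun x => ?_
        have h := abs_norm_sub_norm_le (f x) (g x)
        have h0 : 0 ≤ ‖f x‖ + ‖g x‖ := by positivity
        calc |‖f x‖ ^ 2 - ‖g x‖ ^ 2| = |‖f x‖ - ‖g x‖| * (‖f x‖ + ‖g x‖) := by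
              rw [sq_sub_sq, abs_mul, abs_of_nonneg h0, mul_comm]
          _ ≤ ‖f x - g x‖ * (‖f x‖ + ‖g x‖) := by gcongr
          _ = _ := by simp only [Pi.sub_apply]; ring
    _ ≤ _ := by
        rw [integral_add h1 h2, mul_add]
        exact add_le_add (integral_norm_mul_norm_le hfg hf) (integral_norm_mul_norm_le hfg hg)

/-- The distance from a partial sum to the `L^q` limit is at most the tail of the series of norm
bounds. -/
theorem lpNorm_sum_Icc_sub_le_tsum {q : ENNReal} (hq : 1 ≤ q) {x : ℕ → α → E}
    (hx : ∀ k, MemLp (x k) q μ) {b : ℕ → ℝ} (hxb : ∀ k, lpNorm (x k) q μ ≤ b k)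
    (hb : Summable b) {g : α → E}
    (hlim : Tendsto (fun n => lpNorm (∑ k ∈ Finset.Icc 1 n, x k - g) q μ) atTop (nhds 0))
    (m : ℕ) :
    lpNorm (∑ k ∈ Finset.Icc 1 m, x k - g) q μ ≤ ∑' k, b (k + (m + 1)) := by
  have hb0 : ∀ k, 0 ≤ b k := fun k => lpNorm_nonneg.trans (hxb k)
  have hS : ∀ n, MemLp (∑ k ∈ Finset.Icc 1 n, x k) q μ := fun n =>
    memLp_finsetSum' _ fun k _ => hx k
  have hlim' := hlim.const_add (∑' k, b (k + (m + 1)))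
  rw [add_zero] at hlim'
  refine ge_of_tendsto hlim' ?_
  filter_upwards [eventually_ge_atTop m] with n hn
  refine (lpNorm_sub_le_lpNorm_sub_add_lpNorm_sub (hS m) (hS n) hq).trans ?_
  gcongr
  have hdiff : ∑ k ∈ Finset.Icc 1 n, x k - ∑ k ∈ Finset.Icc 1 m, x k
      = ∑ k ∈ Finset.range (n - m), x (k + (m + 1)) := by
    rw [sub_eq_iff_eq_add', ← Finset.Ico_add_one_right_eq_Icc, ← Finset.Ico_add_one_right_eq_Icc,
      ← Finset.sum_Ico_consecutive x (by omega : 1 ≤ m + 1) (by omega : m + 1 ≤ n + 1),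
      Finset.sum_Ico_eq_sum_range x (m + 1)]
    congr 1
    refine Finset.sum_congr (by congr 1; omega) fun k _ => by rw [add_comm]
  rw [lpNorm_sub_comm, hdiff]
  calc lpNorm (∑ k ∈ Finset.range (n - m), x (k + (m + 1))) q μ
      ≤ ∑ k ∈ Finset.range (n - m), lpNorm (x (k + (m + 1))) q μ :=
        lpNorm_sum_le (fun k _ => hx _) hq
    _ ≤ ∑ k ∈ Finset.range (n - m), b (k + (m + 1)) := Finset.sum_le_sum fun k _ => hxb _
    _ ≤ _ := ((summable_nat_add_iff (m + 1)).2 hb).sum_le_tsum _ fun k _ => hb0 _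

end LpNorm

theorem tendsto_integral_abs_average_sub {α : Type*} [MeasurableSpace α] {μ : Measure α}
    {u v : ℕ → α → ℝ} (huv : ∀ t, Integrable (fun x => |u t x - v t x|) μ)
    {d : ℕ → ℝ} (hd : ∀ t, ∫ x, |u t x - v t x| ∂μ ≤ d t) (hd0 : Tendsto d atTop (nhds 0)) :
    Tendsto (fun N : ℕ => ∫ x, |(1 / (N : ℝ)) * ∑ t ∈ Finset.Icc 1 N, u t x
      - (1 / (N : ℝ)) * ∑ t ∈ Finset.Icc 1 N, v t x| ∂μ) atTop (nhds 0) := by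
  have hces := (hd0.comp (tendsto_add_atTop_nat 1)).cesaro
  refine squeeze_zero (fun N => integral_nonneg fun x => abs_nonneg _) (fun N => ?_) hces
  have hN : (0 : ℝ) ≤ (N : ℝ)⁻¹ := by positivity
  calc ∫ x, |(1 / (N : ℝ)) * ∑ t ∈ Finset.Icc 1 N, u t x
        - (1 / (N : ℝ)) * ∑ t ∈ Finset.Icc 1 N, v t x| ∂μ
      ≤ ∫ x, (N : ℝ)⁻¹ * ∑ t ∈ Finset.Icc 1 N, |u t x - v t x| ∂μ := by
        refine integral_mono_of_nonneg (ae_of_all _ fun x => abs_nonneg _)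
          ((integrable_finsetSum _ fun t _ => huv t).const_mul _) (ae_of_all _ fun x => ?_)
        simp only
        rw [← mul_sub, ← Finset.sum_sub_distrib, abs_mul, one_div, abs_of_nonneg hN]
        gcongr
        exact Finset.abs_sum_le_sum_abs _ _
    _ = (N : ℝ)⁻¹ * ∑ t ∈ Finset.Icc 1 N, ∫ x, |u t x - v t x| ∂μ := by
        rw [integral_const_mul, integral_finsetSum _ fun t _ => huv t]
    _ ≤ (N : ℝ)⁻¹ * ∑ t ∈ Finset.Icc 1 N, d t := by
        gcongr with t
        exact hd t
    _ = (N : ℝ)⁻¹ * ∑ t ∈ Finset.range N, (d ∘ fun t => t + 1) t := by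
        rw [← Finset.Ico_add_one_right_eq_Icc, Finset.sum_Ico_eq_sum_range]
        simp [add_comm]

theorem memLp_toLp_of_integrable_sum_sq {α ι : Type*} [MeasurableSpace α] {μ : Measure α}
    [Fintype ι] {f : α → ι → ℝ} (hf : Measurable f)
    (hf2 : Integrable (fun x => ∑ i, f x i ^ 2) μ) :
    MemLp (fun x => WithLp.toLp 2 (f x)) 2 μ := by
  have hm : AEStronglyMeasurable (fun x => (WithLp.toLp 2 (f x) : EuclideanSpace ℝ ι)) μ :=
    ((WithLp.measurable_toLp 2 (ι → ℝ)).comp hf).aestronglyMeasurable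
  refine (memLp_two_iff_integrable_sq_norm hm).2 ?_
  simpa only [EuclideanSpace.real_norm_sq_eq] using hf2

/-- Equivalence of finite-past and infinite-past empirical losses: with `y` a
strictly stationary, square-integrable, zero-mean process, `(M k)` matrices
with summable operator 2-norms, `ŷ(t|s) = Σ_{k=1}^{t−s} M_k y(t−k)`, and
`ŷ(t)` the `L²` limit of `ŷ(t|s)` as `s → −∞`, the difference between the
finite-past empirical loss `L̂_N = (1/N) Σ_{t=1}^N ‖ŷ(t|0) − y(t)‖²` and the
infinite-past empirical loss `V_N = (1/N) Σ_{t=1}^N ‖ŷ(t) − y(t)‖²` converges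
to `0` in `L¹(P)`.  Here `‖v‖² = Σᵢ vᵢ²` is the squared Euclidean norm. -/
theorem empirical_losses_equivalent
    {Ω : Type*} [MeasurableSpace Ω] (P : Measure Ω) [IsProbabilityMeasure P]
    (p : ℕ) (y : ℤ → Ω → (Fin p → ℝ))
    (hmeas : ∀ t, Measurable (y t))
    (hstat : ∀ (k : ℕ) (t : Fin k → ℤ) (τ : ℤ),
      Measure.map (fun ω (i : Fin k) => y (t i + τ) ω) P
        = Measure.map (fun ω (i : Fin k) => y (t i) ω) P)
    (hL2 : ∀ t, Integrable (fun ω => ∑ i, (y t ω i) ^ 2) P)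
    (hmean : ∀ t i, ∫ ω, y t ω i ∂P = 0)
    (M : ℕ → Matrix (Fin p) (Fin p) ℝ)
    (hM : Summable fun k => ‖Matrix.toEuclideanCLM (𝕜 := ℝ) (M k)‖)
    (yhat : ℤ → ℤ → Ω → (Fin p → ℝ))
    (hyhat : ∀ (t s : ℤ) (ω : Ω),
      yhat t s ω = ∑ k ∈ Finset.Icc 1 (t - s).toNat, (M k).mulVec (y (t - k) ω))
    (ylim : ℤ → Ω → (Fin p → ℝ))
    (hylimmeas : ∀ t, Measurable (ylim t))
    (hylimL2 : ∀ t, Integrable (fun ω => ∑ i, (ylim t ω i) ^ 2) P)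
    (hlim : ∀ t : ℤ, Tendsto
      (fun s : ℤ => ∫ ω, ∑ i, (yhat t s ω i - ylim t ω i) ^ 2 ∂P)
      atBot (nhds 0)) :
    Tendsto (fun N : ℕ => ∫ ω,
        |(1 / (N : ℝ)) * ∑ t ∈ Finset.Icc 1 N, ∑ i, (yhat t 0 ω i - y t ω i) ^ 2
          - (1 / (N : ℝ)) * ∑ t ∈ Finset.Icc 1 N, ∑ i, (ylim t ω i - y t ω i) ^ 2| ∂P)
      atTop (nhds 0) := by
  let Y : ℤ → Ω → EuclideanSpace ℝ (Fin p) := fun t ω => WithLp.toLp 2 (y t ω)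
  let Z : ℤ → Ω → EuclideanSpace ℝ (Fin p) := fun t ω => WithLp.toLp 2 (ylim t ω)
  let A : ℕ → EuclideanSpace ℝ (Fin p) →L[ℝ] EuclideanSpace ℝ (Fin p) :=
    fun k => Matrix.toEuclideanCLM (𝕜 := ℝ) (M k)
  let X : ℤ → ℕ → Ω → EuclideanSpace ℝ (Fin p) := fun t k ω => A k (Y (t - k) ω)
  have hY : ∀ t, MemLp (Y t) 2 P := fun t => memLp_toLp_of_integrable_sum_sq (hmeas t) (hL2 t)
  have hZ : ∀ t, MemLp (Z t) 2 P := fun t =>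
    memLp_toLp_of_integrable_sum_sq (hylimmeas t) (hylimL2 t)
  have hX : ∀ t k, MemLp (X t k) 2 P := fun t k => (A k).comp_memLp' (hY (t - k))
  have hS : ∀ t n, MemLp (∑ k ∈ Finset.Icc 1 n, X t k) 2 P := fun t n =>
    memLp_finsetSum' _ fun k _ => hX t k
  have hyS : ∀ t s ω, WithLp.toLp 2 (yhat t s ω)
      = (∑ k ∈ Finset.Icc 1 (t - s).toNat, X t k) ω := by
    intro t s ω
    simp [hyhat, X, A, Y, Matrix.toEuclideanCLM_toLp, WithLp.toLp_sum]
  have hYc : ∀ t, lpNorm (Y t) 2 P = lpNorm (Y 0) 2 P := by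
    intro t
    rw [lpNorm_two_eq_sqrt (hY t).aestronglyMeasurable,
      lpNorm_two_eq_sqrt (hY 0).aestronglyMeasurable]
    have hφ : Measurable fun v : Fin 1 → Fin p → ℝ => ∑ i, v 0 i ^ 2 := by fun_prop
    have h := congrArg (fun ν => ∫ v, ∑ i, v 0 i ^ 2 ∂ν) (hstat 1 (fun _ => 0) t)
    rw [integral_map (by fun_prop) hφ.aestronglyMeasurable,
      integral_map (by fun_prop) hφ.aestronglyMeasurable] at h
    simpa [Y, EuclideanSpace.real_norm_sq_eq] using congrArg Real.sqrt h
  set c := lpNorm (Y 0) 2 P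
  have hXb : ∀ t k, lpNorm (X t k) 2 P ≤ ‖A k‖ * c := fun t k => by
    simpa only [hYc] using lpNorm_comp_clm_le (A k) (hY (t - k))
  have hb : Summable fun k => ‖A k‖ * c := hM.mul_right c
  have hSlim : ∀ t : ℤ, Tendsto
      (fun n : ℕ => lpNorm (∑ k ∈ Finset.Icc 1 n, X t k - Z t) 2 P) atTop (nhds 0) := by
    intro t
    have hs : Tendsto (fun n : ℕ => t - (n : ℤ)) atTop atBot :=
      tendsto_const_nhds.add_atBot
        (tendsto_neg_atTop_atBot.comp tendsto_natCast_atTop_atTop)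
    have h := (Real.continuous_sqrt.tendsto 0).comp ((hlim t).comp hs)
    rw [Real.sqrt_zero] at h
    refine h.congr fun n => ?_
    rw [lpNorm_two_eq_sqrt ((hS t n).sub (hZ t)).aestronglyMeasurable]
    have hn : (t - (t - (n : ℤ))).toNat = n := by omega
    have hSn : ∀ ω, (∑ k ∈ Finset.Icc 1 n, X t k) ω
        = WithLp.toLp 2 (yhat t (t - (n : ℤ)) ω) := fun ω => by rw [hyS, hn]
    simp only [Function.comp_apply, Pi.sub_apply, hSn, EuclideanSpace.real_norm_sq_eq,
      PiLp.sub_apply, Z]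
  let r : ℕ → ℝ := fun t => ∑' k, ‖A (k + (t + 1))‖ * c
  have hr : Tendsto r atTop (nhds 0) :=
    (tendsto_sum_nat_add fun k => ‖A k‖ * c).comp (tendsto_add_atTop_nat 1)
  have hSZ : ∀ t : ℕ, lpNorm (∑ k ∈ Finset.Icc 1 t, X t k - Z t) 2 P ≤ r t := fun t =>
    lpNorm_sum_Icc_sub_le_tsum one_le_two (hX t) (hXb t) hb (hSlim t) t
  let C : ℝ := ∑' k, ‖A k‖ * c + c
  have hSY : ∀ t : ℕ, lpNorm (∑ k ∈ Finset.Icc 1 t, X t k - Y t) 2 P ≤ C := by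
    intro t
    refine (lpNorm_sub_le (hS t t) one_le_two).trans (add_le_add ?_ (hYc t).le)
    calc _ ≤ ∑ k ∈ Finset.Icc 1 t, lpNorm (X t k) 2 P :=
          lpNorm_sum_le (fun k _ => hX t k) one_le_two
      _ ≤ ∑ k ∈ Finset.Icc 1 t, ‖A k‖ * c := Finset.sum_le_sum fun k _ => hXb t k
      _ ≤ _ := hb.sum_le_tsum _ fun k _ => lpNorm_nonneg.trans (hXb 0 k)
  have hZY : ∀ t : ℕ, lpNorm (Z t - Y t) 2 P ≤ r t + C := fun t => by
    refine (lpNorm_sub_le_lpNorm_sub_add_lpNorm_sub (hZ t) (hS t t) one_le_two).trans ?_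
    rw [lpNorm_sub_comm]
    exact add_le_add (hSZ t) (hSY t)
  have hnat : ∀ (t : ℕ) ω, WithLp.toLp 2 (yhat t 0 ω) = (∑ k ∈ Finset.Icc 1 t, X t k) ω :=
    fun t ω => by rw [hyS]; simp
  have hu : ∀ (t : ℕ) ω, ∑ i, (yhat t 0 ω i - y t ω i) ^ 2
      = ‖(∑ k ∈ Finset.Icc 1 t, X t k - Y t) ω‖ ^ 2 := fun t ω => by
    rw [Pi.sub_apply, ← hnat, EuclideanSpace.real_norm_sq_eq]
    rfl
  have hv : ∀ (t : ℕ) ω, ∑ i, (ylim t ω i - y t ω i) ^ 2 = ‖(Z t - Y t) ω‖ ^ 2 := fun t ω => by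
    rw [EuclideanSpace.real_norm_sq_eq]
    rfl
  simp only [hu, hv]
  have hr0 : ∀ t, 0 ≤ r t := fun t => lpNorm_nonneg.trans (hSZ t)
  refine tendsto_integral_abs_average_sub (d := fun t => r t * (C + (r t + C)))
    (fun t => integrable_abs_norm_sq_sub_norm_sq ((hS t t).sub (hY t)) ((hZ t).sub (hY t)))
    (fun t => ?_) ?_
  · refine (integral_abs_norm_sq_sub_norm_sq_le
      ((hS t t).sub (hY t)) ((hZ t).sub (hY t))).trans ?_
    rw [sub_sub_sub_cancel_right]
    exact mul_le_mul (hSZ t) (add_le_add (hSY t) (hZY t))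
      (add_nonneg lpNorm_nonneg lpNorm_nonneg) (hr0 t)
  · simpa using hr.mul ((hr.add_const C).const_add C)
end

section
/- Discrete-time Lyapunov equation for a Schur-stable matrix: let A be a real n×n matrix with spectral radius strictly less than 1 and let W be a real symmetric positive semidefinite n×n matrix. Then the series P = Σ_{k=0}^∞ A^k W (Aᵀ)^k converges, P is symmetric positive semidefinite, P satisfies P = A P Aᵀ + W, and P is the unique n×n real matrix satisfying this equation. -/
open Matrix

open Filter Topology in
/-- An element of a complex Banach algebra whose spectrum lies in the open unit disc has
powers of geometrically decaying norm. -/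
theorem exists_eventually_norm_pow_le_of_spectrum {E : Type*} [NormedRing E] [NormedAlgebra ℂ E]
    [CompleteSpace E] (a : E) (ha : ∀ μ ∈ spectrum ℂ a, ‖μ‖ < 1) :
    ∃ r : ℝ, 0 ≤ r ∧ r < 1 ∧ ∀ᶠ k : ℕ in atTop, ‖a ^ k‖ ≤ r ^ k := by
  have hlt : spectralRadius ℂ a < 1 := by
    rcases (spectrum ℂ a).eq_empty_or_nonempty with h | h
    · simp [spectralRadius, h]
    · exact_mod_cast spectrum.spectralRadius_lt_of_forall_lt_of_nonempty (r := 1) h ha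
  obtain ⟨r, har, hr⟩ := ENNReal.lt_iff_exists_nnreal_btwn.mp hlt
  refine ⟨r, r.coe_nonneg, by exact_mod_cast hr, ?_⟩
  have hG := spectrum.pow_nnnorm_pow_one_div_tendsto_nhds_spectralRadius a
  filter_upwards [hG.eventually_lt_const har, eventually_gt_atTop 0] with k hk hk0
  have hk' := ENNReal.rpow_le_rpow hk.le (Nat.cast_nonneg (α := ℝ) k)
  rw [← ENNReal.rpow_mul, one_div_mul_cancel (by positivity), ENNReal.rpow_one,
    ENNReal.rpow_natCast] at hk'
  exact_mod_cast hk'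

section Frobenius

attribute [local instance] Matrix.frobeniusNormedRing Matrix.frobeniusNormedAlgebra

open Filter Topology in
/-- For a real matrix `A` with complex spectrum in the open unit disc, the Lyapunov series
`∑ A ^ k * W * Aᵀ ^ k` converges for every `W`. -/
theorem Matrix.summable_pow_mul_mul_transpose_pow {n : Type*} [Fintype n] [DecidableEq n]
    (A W : Matrix n n ℝ)
    (hA : ∀ μ ∈ spectrum ℂ (A.map (fun x : ℝ => (x : ℂ))), ‖μ‖ < 1) :
    Summable fun k : ℕ => A ^ k * W * Aᵀ ^ k := by
  obtain ⟨r, hr0, hr1, hr⟩ := exists_eventually_norm_pow_le_of_spectrum _ hA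
  have hnorm (k : ℕ) : ‖(A.map (fun x : ℝ => (x : ℂ))) ^ k‖ = ‖A ^ k‖ := by
    have h : (A.map (fun x : ℝ => (x : ℂ))) ^ k = (A ^ k).map (fun x : ℝ => (x : ℂ)) :=
      (Matrix.map_pow A Complex.ofRealHom k).symm
    rw [h]
    exact Matrix.frobenius_norm_map_eq _ _ fun x => Complex.norm_real x
  have hgeom : Summable fun k : ℕ => ‖W‖ * (r ^ 2) ^ k :=
    (summable_geometric_of_lt_one (by positivity) (by nlinarith)).mul_left _
  refine Summable.of_norm_bounded_eventually_nat hgeom ?_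
  filter_upwards [hr] with k hk
  rw [hnorm] at hk
  calc ‖A ^ k * W * Aᵀ ^ k‖ ≤ ‖A ^ k‖ * ‖W‖ * ‖Aᵀ ^ k‖ :=
        (norm_mul_le _ _).trans (by gcongr; exact norm_mul_le _ _)
    _ = ‖A ^ k‖ * ‖W‖ * ‖A ^ k‖ := by
        rw [← Matrix.transpose_pow, Matrix.frobenius_norm_transpose]
    _ ≤ r ^ k * ‖W‖ * r ^ k := by gcongr
    _ = ‖W‖ * (r ^ 2) ^ k := by ring

end Frobenius

/-- Discrete-time Lyapunov equation for a Schur-stable matrix: if `A` has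
spectral radius `< 1` (every complex eigenvalue has absolute value `< 1`) and
`W` is symmetric positive semidefinite, then the series
`P = Σ_{k≥0} A^k W (Aᵀ)^k` converges, `P` is symmetric positive semidefinite,
`P = A P Aᵀ + W`, and `P` is the unique solution of this equation. -/
theorem discrete_lyapunov {n : ℕ}
    (A : Matrix (Fin n) (Fin n) ℝ)
    (hA : ∀ μ ∈ spectrum ℂ (A.map (fun x : ℝ => (x : ℂ))), ‖μ‖ < 1)
    (W : Matrix (Fin n) (Fin n) ℝ) (hWsymm : Wᵀ = W)
    (hWpsd : ∀ x : Fin n → ℝ, 0 ≤ x ⬝ᵥ W.mulVec x) :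
    ∃ P : Matrix (Fin n) (Fin n) ℝ,
      HasSum (fun k : ℕ => A ^ k * W * (Aᵀ) ^ k) P ∧
      Pᵀ = P ∧
      (∀ x : Fin n → ℝ, 0 ≤ x ⬝ᵥ P.mulVec x) ∧
      P = A * P * Aᵀ + W ∧
      ∀ P' : Matrix (Fin n) (Fin n) ℝ, P' = A * P' * Aᵀ + W → P' = P := by
  obtain ⟨P, hP⟩ := Matrix.summable_pow_mul_mul_transpose_pow A W hA
  have hfix : P = A * P * Aᵀ + W := by
    have hshift : HasSum (fun k : ℕ => A ^ (k + 1) * W * Aᵀ ^ (k + 1)) (A * P * Aᵀ) := by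
      have hterm (k : ℕ) :
          A ^ (k + 1) * W * Aᵀ ^ (k + 1) = A * (A ^ k * W * Aᵀ ^ k) * Aᵀ := by
        rw [pow_succ' A, pow_succ Aᵀ]
        simp only [Matrix.mul_assoc]
      simp only [hterm]
      exact (hP.mul_left A).mul_right Aᵀ
    refine hP.unique ?_
    simpa using (hasSum_nat_add_iff (f := fun k : ℕ => A ^ k * W * Aᵀ ^ k) 1).mp hshift
  refine ⟨P, hP, ?_, fun x => ?_, hfix, fun P' hP' => ?_⟩
  · refine HasSum.unique (f := fun k : ℕ => A ^ k * W * Aᵀ ^ k) ?_ hP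
    convert hP.matrix_transpose using 2 with k
    simp [Matrix.transpose_mul, Matrix.transpose_pow, hWsymm, Matrix.mul_assoc]
  · let q : Matrix (Fin n) (Fin n) ℝ →+ ℝ :=
      { toFun := fun M => x ⬝ᵥ M.mulVec x
        map_zero' := by simp
        map_add' := fun M N => by rw [Matrix.add_mulVec, dotProduct_add] }
    have hq : Continuous q :=
      continuous_const.dotProduct (continuous_id.matrix_mulVec continuous_const)
    refine (hP.map q hq).nonneg fun k => ?_
    have h := hWpsd ((Aᵀ ^ k).mulVec x)
    rwa [← Matrix.transpose_pow, Matrix.mulVec_transpose, ← Matrix.dotProduct_mulVec,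
      ← Matrix.mulVec_transpose, Matrix.mulVec_mulVec, Matrix.mulVec_mulVec,
      Matrix.transpose_pow] at h
  · have hD : P' - P = A * (P' - P) * Aᵀ := by
      rw [Matrix.mul_sub, Matrix.sub_mul]
      nth_rewrite 1 [hP', hfix]
      abel
    have hpow (k : ℕ) : A ^ k * (P' - P) * Aᵀ ^ k = P' - P := by
      induction k with
      | zero => simp
      | succ k ih =>
        rw [pow_succ A, pow_succ' Aᵀ]
        calc A ^ k * A * (P' - P) * (Aᵀ * Aᵀ ^ k)
            = A ^ k * (A * (P' - P) * Aᵀ) * Aᵀ ^ k := by simp only [Matrix.mul_assoc]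
          _ = P' - P := by rw [← hD, ih]
    have hlim := (Matrix.summable_pow_mul_mul_transpose_pow A (P' - P) hA).tendsto_atTop_zero
    simp only [hpow] at hlim
    exact sub_eq_zero.mp (tendsto_nhds_unique tendsto_const_nhds hlim)
end
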